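/- arXiv:1306.1810 — 4 statements merged into one kernel-verified Lean document; each statement's English description precedes it below -/
import Mathlib

section
/- Let v, w ∈ k^{r×n} have equal matroids, i.e. for every subset S ⊆ {1,…,n}, the columns {v_j : j ∈ S} are linearly independent if and only if the columns {w_j : j ∈ S} are linearly independent. Then the orbit closures X_v and X_w have the same multigraded Hilbert function: H_v(a,b) = H_w(a,b) for every (a,b) ∈ ℕ^r × ℕ^n. (This is the Hilbert-series form of the statement that the class of X_v in G-equivariant K-theory of k^{r×n}, i.e. its K-polynomial, is a function of the matroid M(v).) -/
open MvPolynomial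

noncomputable section

/-- The orbit of `v` under `GL_r(k) × (k^×)^n` acting by `(g,t)·v = g v diag(t)⁻¹`. -/
def matOrbit (k : Type*) [Field k] {r n : ℕ} (v : Matrix (Fin r) (Fin n) k) :
    Set (Matrix (Fin r) (Fin n) k) :=
  {w | ∃ g : (Matrix (Fin r) (Fin r) k)ˣ, ∃ t : Fin n → kˣ,
    w = Matrix.of fun i j => (g.1 * v) i j * ((t j)⁻¹ : kˣ)}

/-- The vanishing ideal of a set of matrices, inside `k[x_ij]`. -/
def vanIdeal (k : Type*) [Field k] {r n : ℕ} (S : Set (Matrix (Fin r) (Fin n) k)) :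
    Ideal (MvPolynomial (Fin r × Fin n) k) where
  carrier := {p | ∀ w ∈ S, eval (fun ij => w ij.1 ij.2) p = 0}
  add_mem' := by
    intro a b ha hb w hw
    simp [map_add, ha w hw, hb w hw]
  zero_mem' := by
    intro w hw; simp
  smul_mem' := by
    intro c p hp w hw
    simp [smul_eq_mul, hp w hw]

/-- The zero locus in matrix space of an ideal of `k[x_ij]`. -/
def zLocus {k : Type*} [Field k] {r n : ℕ} (I : Ideal (MvPolynomial (Fin r × Fin n) k)) :
    Set (Matrix (Fin r) (Fin n) k) :=
  {w | ∀ p ∈ I, eval (fun ij => w ij.1 ij.2) p = 0}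

/-- The orbit closure `X_v` (zero locus of the vanishing ideal of the orbit). -/
def Xcl (k : Type*) [Field k] {r n : ℕ} (v : Matrix (Fin r) (Fin n) k) :
    Set (Matrix (Fin r) (Fin n) k) :=
  zLocus (vanIdeal k (matOrbit k v))

/-- The span of the monomials of multidegree `(a, b)`. -/
def gradedPiece (k : Type*) [Field k] (r n : ℕ) (a : Fin r → ℕ) (b : Fin n → ℕ) :
    Submodule k (MvPolynomial (Fin r × Fin n) k) :=
  Submodule.span k {p | ∃ α : (Fin r × Fin n) →₀ ℕ,
    (∀ i, (∑ j, α (i, j)) = a i) ∧ (∀ j, (∑ i, α (i, j)) = b j) ∧ p = monomial α 1}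

/-- The multigraded Hilbert function of the coordinate ring of `X_v`:
the dimension of the image of the degree-`(a,b)` monomial span in
`k[x_ij]/I(O(v))`. -/
def hilbFn (k : Type*) [Field k] {r n : ℕ} (v : Matrix (Fin r) (Fin n) k)
    (a : Fin r → ℕ) (b : Fin n → ℕ) : ℕ :=
  Module.finrank k
    ((gradedPiece k r n a b).map
      (Submodule.mkQ ((vanIdeal k (matOrbit k v)).restrictScalars k)))

namespace LinearProduct

variable {k R : Type*} [Field k] [CommRing R] [Algebra k R]

/-- The degree `d` part of the ideal generated by the space `Y` of linear forms, inside the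
subalgebra generated by `V`. -/
def idealPart (Y V : Submodule k R) : ℕ → Submodule k R
  | 0 => ⊥
  | n + 1 => Y * V ^ n

theorem idealPart_mono {Y Y' : Submodule k R} (h : Y ≤ Y') (V : Submodule k R) (d : ℕ) :
    idealPart Y V d ≤ idealPart Y' V d := by
  cases d with
  | zero => exact le_rfl
  | succ n => exact mul_le_mul_left h _

theorem mul_idealPart_le {X V : Submodule k R} (h : X ≤ V) (Y : Submodule k R) (d : ℕ) :
    X * idealPart Y V d ≤ idealPart Y V (d + 1) := by
  cases d with
  | zero => simp [idealPart]
  | succ n =>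
    calc X * (Y * V ^ n) ≤ V * (Y * V ^ n) := mul_le_mul_left h _
      _ = Y * V ^ (n + 1) := by rw [pow_succ]; ring

theorem mul_mem_idealPart {V : Submodule k R} {x f : R} {d : ℕ} {Y : Submodule k R} (hx : x ∈ V)
    (hf : f ∈ idealPart Y V d) : x * f ∈ idealPart Y V (d + 1) :=
  mul_idealPart_le le_rfl Y d (Submodule.mul_mem_mul hx hf)

theorem idealPart_sup (Y Y' V : Submodule k R) (d : ℕ) :
    idealPart (Y ⊔ Y') V d = idealPart Y V d ⊔ idealPart Y' V d := by
  cases d with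
  | zero => simp [idealPart]
  | succ n => exact Submodule.sup_mul _ _ _

/-- Every element of `V` outside a subspace `W` can be killed by an algebra endomorphism that
fixes a complementary hyperplane of `V` containing `W`. -/
def HasRetractions (V : Submodule k R) : Prop :=
  ∀ W ≤ V, ∀ y ∈ V, y ∉ W → ∃ θ : R →ₐ[k] R, ∃ V' : Submodule k R,
    W ≤ V' ∧ V' ≤ V ∧ V ≤ V' ⊔ Submodule.span k {y} ∧ (∀ x ∈ V', θ x = x) ∧ θ y = 0

theorem pow_succ_le_of_le_sup {V V' : Submodule k R} {y : R} (hV' : V' ≤ V) (hy : y ∈ V)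
    (h : V ≤ V' ⊔ Submodule.span k {y}) (n : ℕ) :
    V ^ (n + 1) ≤ V' ^ (n + 1) ⊔ Submodule.span k {y} * V ^ n := by
  induction n with
  | zero => simpa using h
  | succ n ih =>
    have hy' : Submodule.span k {y} ≤ V := by simpa using hy
    calc V ^ (n + 2) = V ^ (n + 1) * V := pow_succ _ _
      _ ≤ (V' ^ (n + 1) ⊔ Submodule.span k {y} * V ^ n) * V := mul_le_mul_left ih _
      _ = V' ^ (n + 1) * V ⊔ Submodule.span k {y} * V ^ (n + 1) := by
        rw [Submodule.sup_mul, mul_assoc, pow_succ V n]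
      _ ≤ (V' ^ (n + 1) * (V' ⊔ Submodule.span k {y})) ⊔ Submodule.span k {y} * V ^ (n + 1) :=
        sup_le_sup_right (mul_le_mul_right h _) _
      _ ≤ _ := by
        rw [Submodule.mul_sup, ← pow_succ, mul_comm (V' ^ (n + 1)) (Submodule.span k {y})]
        refine sup_le (sup_le le_sup_left (le_sup_of_le_right ?_)) le_sup_right
        exact mul_le_mul_right (pow_le_pow_left' hV' _) _

theorem mem_of_mul_mem [IsDomain R] {F M M' : Submodule k R} {y f : R} (θ : R →ₐ[k] R)
    (hF : ∀ x ∈ F, θ x = x) (hy : θ y = 0) (hy0 : y ≠ 0)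
    (hM : M ≤ F ⊔ Submodule.span k {y} * M') (hf : y * f ∈ M) : f ∈ M' := by
  obtain ⟨a, ha, b, hb, hab⟩ := Submodule.mem_sup.1 (hM hf)
  obtain ⟨q, hq, rfl⟩ := Submodule.mem_span_singleton_mul.1 hb
  have h0 : a = 0 := by
    have := congrArg θ hab
    simpa [hF a ha, hy] using this
  rw [h0, zero_add] at hab
  rwa [← mul_left_cancel₀ hy0 hab]

theorem algHom_fixes_mul {A B : Submodule k R} {θ : R →ₐ[k] R} (hA : ∀ x ∈ A, θ x = x)
    (hB : ∀ x ∈ B, θ x = x) : ∀ x ∈ A * B, θ x = x := by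
  intro x hx
  induction hx using Submodule.mul_induction_on' with
  | mem_mul_mem a ha b hb => rw [map_mul, hA a ha, hB b hb]
  | add a _ b _ h1 h2 => rw [map_add, h1, h2]

theorem algHom_fixes_pow {A : Submodule k R} {θ : R →ₐ[k] R} (hA : ∀ x ∈ A, θ x = x) (n : ℕ) :
    ∀ x ∈ A ^ n, θ x = x := by
  induction n with
  | zero => simp
  | succ n ih => rw [pow_succ]; exact algHom_fixes_mul ih hA

theorem algHom_fixes_sup {A B : Submodule k R} {θ : R →ₐ[k] R} (hA : ∀ x ∈ A, θ x = x)
    (hB : ∀ x ∈ B, θ x = x) : ∀ x ∈ A ⊔ B, θ x = x := by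
  intro x hx
  obtain ⟨a, ha, b, hb, rfl⟩ := Submodule.mem_sup.1 hx
  rw [map_add, hA a ha, hB b hb]

theorem algHom_fixes_prod {ι : Type*} {L : ι → Submodule k R} {θ : R →ₐ[k] R} (S : Finset ι)
    (hL : ∀ i ∈ S, ∀ x ∈ L i, θ x = x) : ∀ x ∈ ∏ i ∈ S, L i, θ x = x := by
  classical
  induction S using Finset.induction_on with
  | empty => simp
  | insert i S hi ih =>
    rw [Finset.prod_insert hi]
    exact algHom_fixes_mul (hL i (by simp)) (ih fun j hj => hL j (by simp [hj]))

/-- Cancellation of a linear form lying outside the span of all the linear forms involved. -/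
theorem mem_of_mul_mem_of_notMem [IsDomain R] {V : Submodule k R} (hV : HasRetractions V)
    {ι : Type*} {L : ι → Submodule k R} (S : Finset ι) {Y : Submodule k R} (hL : ∀ i, L i ≤ V)
    (hY : Y ≤ V) {y : R} (hy : y ∈ V) (hyn : y ∉ (⨆ i ∈ S, L i) ⊔ Y) (e d : ℕ) {f : R}
    (hf : y * f ∈ (∏ i ∈ S, L i) * V ^ (e + 1) ⊔ idealPart Y V (d + 1)) :
    f ∈ (∏ i ∈ S, L i) * V ^ e ⊔ idealPart Y V d := by
  obtain ⟨θ, V', hW, hV', hVy, hθ, hθy⟩ :=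
    hV _ (sup_le (iSup₂_le fun i _ => hL i) hY) y hy hyn
  have hy0 : y ≠ 0 := by rintro rfl; exact hyn (Submodule.zero_mem _)
  have hP : ∀ x ∈ ∏ i ∈ S, L i, θ x = x := algHom_fixes_prod S fun i hi x hx =>
    hθ x (hW (Submodule.mem_sup_left (Submodule.mem_iSup_of_mem i
      (Submodule.mem_iSup_of_mem hi hx))))
  have hYf : ∀ x ∈ Y, θ x = x := fun x hx => hθ x (hW (Submodule.mem_sup_right hx))
  have hYd : ∃ F : Submodule k R, (∀ x ∈ F, θ x = x) ∧
      idealPart Y V (d + 1) ≤ F ⊔ Submodule.span k {y} * idealPart Y V d := by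
    cases d with
    | zero => exact ⟨Y, hYf, by simp [idealPart]⟩
    | succ n =>
      refine ⟨Y * V' ^ (n + 1), algHom_fixes_mul hYf (algHom_fixes_pow hθ _), ?_⟩
      calc Y * V ^ (n + 1) ≤ Y * (V' ^ (n + 1) ⊔ Submodule.span k {y} * V ^ n) :=
            mul_le_mul_right (pow_succ_le_of_le_sup hV' hy hVy n) _
        _ = _ := by rw [Submodule.mul_sup, mul_left_comm]; rfl
  obtain ⟨F, hF, hle⟩ := hYd
  refine mem_of_mul_mem (F := (∏ i ∈ S, L i) * V' ^ (e + 1) ⊔ F) θ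
    (algHom_fixes_sup (algHom_fixes_mul hP (algHom_fixes_pow hθ _)) hF) hθy hy0 ?_ hf
  have h1 : (∏ i ∈ S, L i) * V ^ (e + 1) ≤ (∏ i ∈ S, L i) * V' ^ (e + 1) ⊔
      Submodule.span k {y} * ((∏ i ∈ S, L i) * V ^ e) :=
    calc _ ≤ (∏ i ∈ S, L i) * (V' ^ (e + 1) ⊔ Submodule.span k {y} * V ^ e) :=
          mul_le_mul_right (pow_succ_le_of_le_sup hV' hy hVy e) _
      _ = _ := by rw [Submodule.mul_sup, mul_left_comm]
  rw [Submodule.mul_sup]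
  refine sup_le (h1.trans ?_) (hle.trans ?_)
  · exact sup_le_sup le_sup_left le_sup_left
  · exact sup_le_sup le_sup_right le_sup_right

/-- `y` lies in `V` and avoids every proper subspace of `V` spanned by `Y` and some of the
`L i`. -/
def IsGeneric {ι : Type*} (L : ι → Submodule k R) (V Y : Submodule k R) (y : R) : Prop :=
  y ∈ V ∧ ∀ S : Finset ι, (⨆ i ∈ S, L i) ⊔ Y ≠ V → y ∉ (⨆ i ∈ S, L i) ⊔ Y

theorem exists_isGeneric [Infinite k] {ι : Type*} [Finite ι] {L : ι → Submodule k R}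
    {V Y : Submodule k R} (hL : ∀ i, L i ≤ V) (hY : Y ≤ V) : ∃ y, IsGeneric L V Y y := by
  classical
  have := Fintype.ofFinite ι
  let s : Finset (Finset ι) := Finset.univ.filter fun S => (⨆ i ∈ S, L i) ⊔ Y ≠ V
  let W : Finset ι → Subspace k V := fun S => ((⨆ i ∈ S, L i) ⊔ Y).comap V.subtype
  have htop : ∀ S ∈ s, W S ≠ ⊤ := by
    intro S hS h
    refine (Finset.mem_filter.1 hS).2 (le_antisymm (sup_le (iSup₂_le fun i _ => hL i) hY) ?_)
    exact Submodule.comap_subtype_eq_top.1 h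
  have hne : ⋃ p ∈ s.image W, (p : Set V) ≠ Set.univ :=
    Subspace.biUnion_ne_univ_of_top_notMem (by
      intro h
      obtain ⟨S, hS, h⟩ := Finset.mem_image.1 h
      exact htop S hS h)
  obtain ⟨y, hy⟩ := (Set.ne_univ_iff_exists_notMem _).1 hne
  refine ⟨y, y.2, fun S hS h => hy ?_⟩
  simp only [Set.mem_iUnion]
  exact ⟨W S, Finset.mem_image_of_mem _ (by simp [s, hS]), h⟩

theorem codim_induction {V : Submodule k R} [FiniteDimensional k V] {motive : Submodule k R → Prop}
    (step : ∀ Y ≤ V, (∀ Y' ≤ V, Y < Y' → motive Y') → motive Y) : ∀ Y ≤ V, motive Y := by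
  intro Y
  induction hm : Module.finrank k V - Module.finrank k Y using Nat.strong_induction_on
    generalizing Y with
  | _ m ih =>
    intro hY
    refine step Y hY fun Y' hY' hlt => ih _ ?_ Y' rfl hY'
    have : FiniteDimensional k Y' := Submodule.finiteDimensional_of_le hY'
    have h1 := Submodule.finrank_lt_finrank_of_lt hlt
    have h2 := Submodule.finrank_mono hY'
    omega

theorem prod_le_pow {ι : Type*} {L : ι → Submodule k R} {V : Submodule k R} (hL : ∀ i, L i ≤ V)
    (S : Finset ι) : ∏ i ∈ S, L i ≤ V ^ S.card := by
  classical
  induction S using Finset.induction_on with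
  | empty => simp
  | insert i S hi ih =>
    rw [Finset.prod_insert hi, Finset.card_insert_of_notMem hi, pow_succ']
    exact mul_le_mul' (hL i) ih

/-- Multiplication by a generic linear form is injective on the quotient by a product of linear
ideals (plus a linear ideal), from the degree of the generators of the product on. -/
theorem mem_of_mul_mem_of_isGeneric [IsDomain R] [Infinite k] {ι : Type*} [Finite ι]
    {V : Submodule k R} [FiniteDimensional k V] (hV : HasRetractions V) {L : ι → Submodule k R}
    (hL : ∀ i, L i ≤ V) : ∀ Y ≤ V, ∀ y, IsGeneric L V Y y → ∀ (S : Finset ι) (e : ℕ),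
      ∀ f ∈ V ^ (S.card + e),
      y * f ∈ (∏ i ∈ S, L i) * V ^ (e + 1) ⊔ idealPart Y V (S.card + e + 1) →
      f ∈ (∏ i ∈ S, L i) * V ^ e ⊔ idealPart Y V (S.card + e) := by
  classical
  refine codim_induction fun Y hY ihY y hy S => ?_
  induction hN : S.card generalizing S with
  | zero =>
    intro e f hf _
    obtain rfl := Finset.card_eq_zero.1 hN
    exact Submodule.mem_sup_left (by simpa using hf)
  | succ N ihN =>
    intro e f hf hyf
    by_cases hspan : (⨆ i ∈ S, L i) ⊔ Y = V
    swap
    · exact mem_of_mul_mem_of_notMem hV S hL hY hy.1 (hy.2 S hspan) e _ hyf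
    have hadd : N + 1 + e = N + (e + 1) := by omega
    have hmul : ∀ i ∈ S, ∀ n, L i * ((∏ j ∈ S.erase i, L j) * V ^ n) = (∏ j ∈ S, L j) * V ^ n :=
      fun i hi n => by rw [← mul_assoc, Finset.mul_prod_erase S L hi]
    have herase : ∀ i ∈ S, ∀ n, (∏ j ∈ S, L j) * V ^ n ≤ (∏ j ∈ S.erase i, L j) * V ^ (n + 1) :=
      fun i hi n => by
        rw [← hmul i hi, pow_succ', mul_left_comm]
        exact mul_le_mul_right (mul_le_mul_left (hL i) _) _
    -- membership of `x * g` for all `x ∈ V` follows from the `L i` and `Y`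
    have hsocle : ∀ (g : R) (n : ℕ), g ∈ V ^ (N + n) →
        (∀ i ∈ S, g ∈ (∏ j ∈ S.erase i, L j) * V ^ n ⊔ idealPart Y V (N + n)) →
        ∀ x ∈ V, x * g ∈ (∏ j ∈ S, L j) * V ^ n ⊔ idealPart Y V (N + n + 1) := by
      intro g n hgV hg
      let Q : Submodule k R := ((∏ j ∈ S, L j) * V ^ n ⊔ idealPart Y V (N + n + 1)).comap
        (LinearMap.mulRight k g)
      change V ≤ Q
      rw [← hspan]
      refine sup_le (iSup₂_le fun i hi x hx => ?_) fun x hx => ?_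
      · have : x * g ∈ L i * ((∏ j ∈ S.erase i, L j) * V ^ n ⊔ idealPart Y V (N + n)) :=
          Submodule.mul_mem_mul hx (hg i hi)
        rw [Submodule.mul_sup, hmul i hi] at this
        exact sup_le_sup_left (mul_idealPart_le (hL i) Y _) _ this
      · exact Submodule.mem_sup_right (Submodule.mul_mem_mul hx hgV)
    by_cases hYV : Y = V
    · subst hYV
      refine Submodule.mem_sup_right ?_
      rw [hadd, ← add_assoc, idealPart, ← pow_succ']
      convert hf using 2
      omega
    have hyY : y ∉ Y := by simpa using hy.2 ∅ (by simpa using hYV)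
    let Y' := Y ⊔ Submodule.span k {y}
    have hY' : Y' ≤ V := sup_le hY (by simpa using hy.1)
    have hlt : Y < Y' := lt_of_le_of_ne le_sup_left fun h =>
      hyY (h ▸ Submodule.mem_sup_right (Submodule.mem_span_singleton_self y))
    have hfS : ∀ i ∈ S, f ∈ (∏ j ∈ S.erase i, L j) * V ^ (e + 1) ⊔ idealPart Y V (N + (e + 1)) := by
      intro i hi
      refine ihN (S.erase i) (by rw [Finset.card_erase_of_mem hi, hN]; rfl) (e + 1) f
        (hadd ▸ hf) ?_
      rw [← hadd]
      exact sup_le_sup_right (herase i hi _) _ hyf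
    have hfV := hsocle f (e + 1) (hadd ▸ hf) hfS
    have hfY' : f ∈ (∏ i ∈ S, L i) * V ^ e ⊔ idealPart Y' V (N + 1 + e) := by
      by_cases hYV' : Y' = V
      · rw [hYV']
        refine Submodule.mem_sup_right ?_
        rw [hadd, ← add_assoc, idealPart, ← pow_succ']
        convert hf using 2
        omega
      obtain ⟨y', hy'⟩ := exists_isGeneric hL hY'
      have := ihY Y' hY' hlt y' hy' S e f (by rwa [hN]) (by
        rw [hN, hadd]
        exact sup_le_sup_left (idealPart_mono le_sup_left _ _) _ (hfV y' hy'.1))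
      rwa [hN] at this
    rw [idealPart_sup, ← sup_assoc] at hfY'
    obtain ⟨j, hj, g, hg, hjg⟩ := Submodule.mem_sup.1 hfY'
    have hde : N + 1 + e = N + e + 1 := by omega
    rw [hde, idealPart] at hg
    obtain ⟨f', hf', rfl⟩ := Submodule.mem_span_singleton_mul.1 hg
    have hfS' : ∀ i ∈ S, f' ∈ (∏ j ∈ S.erase i, L j) * V ^ e ⊔ idealPart Y V (N + e) := by
      intro i hi
      refine ihN (S.erase i) (by rw [Finset.card_erase_of_mem hi, hN]; rfl) e f' hf' ?_
      have h1 : y * f' = f - j := by rw [← hjg]; ring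
      rw [h1]
      refine Submodule.sub_mem _ (hfS i hi) ?_
      rw [hde] at hj
      exact sup_le_sup_right (herase i hi _) _ hj
    rw [← hjg]
    refine Submodule.add_mem _ hj ?_
    rw [hde]
    exact hsocle f' e hf' hfS' y hy.1

/-- The degree `d` part of the product of the linear ideals generated by `L i`, `i ∈ T`. -/
def piece {ι : Type*} (L : ι → Submodule k R) (V : Submodule k R) (d : ℕ) (T : Finset ι) :
    Submodule k R :=
  (∏ i ∈ T, L i) * V ^ (d - T.card)

theorem piece_le {ι : Type*} [Fintype ι] {L : ι → Submodule k R} {V : Submodule k R}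
    (hL : ∀ i, L i ≤ V) {d : ℕ} (hd : Fintype.card ι ≤ d) (T : Finset ι) :
    piece L V d T ≤ V ^ d := by
  have h := T.card_le_univ
  calc piece L V d T ≤ V ^ T.card * V ^ (d - T.card) := mul_le_mul_left (prod_le_pow hL T) _
    _ = V ^ d := by rw [← pow_add]; congr 1; omega

section Cube

variable {ι : Type*} [LinearOrder ι]

/-- The Koszul sign of inserting `i` into `T` or removing it from `T`. -/
def koszulSign (R : Type*) [CommRing R] (i : ι) (T : Finset ι) : R :=
  (-1) ^ (T.filter (· < i)).card

theorem koszulSign_mul_self (i : ι) (T : Finset ι) :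
    koszulSign R i T * koszulSign R i T = 1 := by
  rw [koszulSign, ← mul_pow]; simp

theorem koszulSign_mul_mem {M : Submodule k R} (i : ι) (T : Finset ι) {x : R} (hx : x ∈ M) :
    koszulSign R i T * x ∈ M := by
  rcases neg_one_pow_eq_or R (T.filter (· < i)).card with h | h <;> simp [koszulSign, h, hx]

theorem koszulSign_insert {i j : ι} {T : Finset ι} (hj : j ∉ T) :
    koszulSign R i (insert j T) = (if j < i then -1 else 1) * koszulSign R i T := by
  rw [koszulSign, Finset.filter_insert]
  split_ifs with h
  · rw [Finset.card_insert_of_notMem (by simp [hj]), pow_succ', koszulSign]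
  · rw [one_mul, koszulSign]

variable [Fintype ι]

/-- The differential of the cube complex with total space `Finset ι → R`. -/
def bdry (R : Type*) [CommRing R] (ι : Type*) [LinearOrder ι] [Fintype ι] :
    (Finset ι → R) →ₗ[R] (Finset ι → R) where
  toFun z T := ∑ i ∈ Tᶜ, koszulSign R i T * z (insert i T)
  map_add' x y := by
    ext T
    simp [mul_add, Finset.sum_add_distrib]
  map_smul' c x := by
    ext T
    simp [Finset.mul_sum, mul_left_comm]

theorem bdry_apply (z : Finset ι → R) (T : Finset ι) :
    bdry R ι z T = ∑ i ∈ Tᶜ, koszulSign R i T * z (insert i T) := rfl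

/-- The homotopy of the cube complex given by a family of elements. -/
def homotopy (l : ι → R) (z : Finset ι → R) (T : Finset ι) : R :=
  ∑ i ∈ T, koszulSign R i T * (l i * z (T.erase i))

theorem bdry_bdry (z : Finset ι → R) : bdry R ι (bdry R ι z) = 0 := by
  ext T
  simp only [bdry_apply, Pi.zero_apply, Finset.mul_sum]
  rw [Finset.sum_sigma']
  refine Finset.sum_involution (fun x _ => ⟨x.2, x.1⟩) ?_ ?_ ?_ ?_
  · rintro ⟨i, j⟩ h
    simp only [Finset.mem_sigma, Finset.mem_compl, Finset.mem_insert, not_or] at h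
    obtain ⟨hi, hij, hj⟩ := h
    simp only
    rw [koszulSign_insert hi, koszulSign_insert hj, Finset.insert_comm]
    rcases lt_or_gt_of_ne hij with h | h
    · rw [if_neg h.not_gt, if_pos h]; ring
    · rw [if_neg h.not_gt, if_pos h]; ring
  · rintro ⟨i, j⟩ h _ heq
    simp only [Finset.mem_sigma, Finset.mem_compl, Finset.mem_insert, not_or] at h
    simp only [Sigma.mk.injEq] at heq
    exact h.2.1 heq.1
  · rintro ⟨i, j⟩ h
    simp only [Finset.mem_sigma, Finset.mem_compl, Finset.mem_insert, not_or] at h ⊢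
    exact ⟨h.2.2, Ne.symm h.2.1, h.1⟩
  · intros; rfl

theorem bdry_homotopy_add (l : ι → R) (z : Finset ι → R) (T : Finset ι) :
    bdry R ι (homotopy l z) T + homotopy l (bdry R ι z) T = (∑ i, l i) * z T := by
  have h1 : bdry R ι (homotopy l z) T = ∑ j ∈ Tᶜ, (l j * z T + ∑ i ∈ T,
      koszulSign R j T * (koszulSign R i (insert j T) * (l i * z ((insert j T).erase i)))) := by
    rw [bdry_apply]
    refine Finset.sum_congr rfl fun j hj => ?_
    have hj : j ∉ T := by simpa using hj
    rw [homotopy, Finset.sum_insert hj, mul_add, Finset.mul_sum, Finset.erase_insert hj,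
      koszulSign_insert hj, if_neg (lt_irrefl j), one_mul, ← mul_assoc, koszulSign_mul_self,
      one_mul]
  have h2 : homotopy l (bdry R ι z) T = ∑ i ∈ T, (l i * z T + ∑ j ∈ Tᶜ,
      koszulSign R i T * (l i * (koszulSign R j (T.erase i) * z (insert j (T.erase i))))) := by
    rw [homotopy]
    refine Finset.sum_congr rfl fun i hi => ?_
    have hsgn : koszulSign R i (T.erase i) = koszulSign R i T := by
      conv_rhs => rw [← Finset.insert_erase hi]
      rw [koszulSign_insert (Finset.notMem_erase i T), if_neg (lt_irrefl i), one_mul]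
    rw [bdry_apply, Finset.compl_erase, Finset.sum_insert (by simpa using hi), mul_add, mul_add,
      Finset.insert_erase hi, Finset.mul_sum, Finset.mul_sum, hsgn]
    congr 1
    linear_combination (l i * z T) * koszulSign_mul_self (R := R) i T
  rw [h1, h2, Finset.sum_add_distrib, Finset.sum_add_distrib, Finset.sum_comm (s := T),
    add_add_add_comm, ← Finset.sum_add_distrib, Finset.sum_mul]
  rw [add_eq_left.2, ← Finset.sum_compl_add_sum T]
  refine Finset.sum_eq_zero fun j hj => ?_
  rw [← Finset.sum_add_distrib]
  refine Finset.sum_eq_zero fun i hi => ?_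
  have hj : j ∉ T := by simpa using hj
  have hij : i ≠ j := by rintro rfl; exact hj hi
  have hT := Finset.insert_erase hi
  have e1 : koszulSign R j T = (if i < j then -1 else 1) * koszulSign R j (T.erase i) := by
    conv_lhs => rw [← hT]
    exact koszulSign_insert (Finset.notMem_erase i T)
  rw [Finset.erase_insert_of_ne hij.symm, e1, koszulSign_insert hj]
  rcases lt_or_gt_of_ne hij with h | h
  · rw [if_neg h.not_gt, if_pos h]; ring
  · rw [if_neg h.not_gt, if_pos h]; ring

variable {L : ι → Submodule k R} {V : Submodule k R}

theorem bdry_mem_piece (hL : ∀ i, L i ≤ V) {d : ℕ} (hd : Fintype.card ι ≤ d) {z : Finset ι → R}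
    (hz : ∀ T, z T ∈ piece L V d T) (T : Finset ι) : bdry R ι z T ∈ piece L V d T := by
  refine Submodule.sum_mem _ fun i hi => koszulSign_mul_mem i T ?_
  have hi : i ∉ T := by simpa using hi
  have h := (insert i T).card_le_univ
  rw [Finset.card_insert_of_notMem hi] at h
  have hle : piece L V d (insert i T) ≤ piece L V d T := by
    have e : d - T.card = d - (T.card + 1) + 1 := by omega
    rw [piece, piece, Finset.prod_insert hi, Finset.card_insert_of_notMem hi, e, pow_succ',
      mul_assoc, mul_left_comm]
    exact mul_le_mul_right (mul_le_mul_left (hL i) _) _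
  exact hle (hz _)

theorem homotopy_mem_piece {d : ℕ} (hd : Fintype.card ι ≤ d) {z : Finset ι → R}
    (hz : ∀ T, z T ∈ piece L V d T) {l : ι → R} (hl : ∀ i, l i ∈ L i) (T : Finset ι) :
    homotopy l z T ∈ piece L V (d + 1) T := by
  refine Submodule.sum_mem _ fun i hi => koszulSign_mul_mem i T ?_
  have h := T.card_le_univ
  have h0 := Finset.card_pos.2 ⟨i, hi⟩
  have := Submodule.mul_mem_mul (hl i) (hz (T.erase i))
  rw [piece, ← mul_assoc, Finset.mul_prod_erase T L hi, Finset.card_erase_of_mem hi] at this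
  rw [piece]
  convert this using 3
  omega

/-- If the `L i` span `V`, the cube complex of products of linear ideals is exact in all degrees
that are at least the number of ideals; this is proved modulo any linear ideal. -/
theorem exists_sub_bdry_mem [IsDomain R] [Infinite k] [Nonempty ι] [FiniteDimensional k V]
    (hV : HasRetractions V) (hL : ∀ i, L i ≤ V) :
    ∀ Y ≤ V, (⨆ i, L i) ⊔ Y = V → ∀ d, Fintype.card ι ≤ d → ∀ z : Finset ι → R,
      (∀ T, z T ∈ piece L V d T) → (∀ T, bdry R ι z T ∈ idealPart Y V d) →
      ∃ u : Finset ι → R, (∀ T, u T ∈ piece L V d T) ∧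
        ∀ T, z T - bdry R ι u T ∈ idealPart Y V d := by
  refine codim_induction fun Y hY ih hspan d hd z hz hbz => ?_
  have hcard : 0 < Fintype.card ι := Fintype.card_pos
  by_cases hYV : Y = V
  · refine ⟨0, fun T => Submodule.zero_mem _, fun T => ?_⟩
    subst hYV
    obtain ⟨n, rfl⟩ : ∃ n, d = n + 1 := ⟨d - 1, by omega⟩
    have := piece_le hL hd T (hz T)
    simpa [idealPart, pow_succ'] using this
  obtain ⟨y, hy⟩ := exists_isGeneric hL hY
  have hyY : y ∉ Y := by simpa using hy.2 ∅ (by simpa using hYV)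
  let Y' := Y ⊔ Submodule.span k {y}
  have hY' : Y' ≤ V := sup_le hY (by simpa using hy.1)
  have hlt : Y < Y' := lt_of_le_of_ne le_sup_left fun h =>
    hyY (h ▸ Submodule.mem_sup_right (Submodule.mem_span_singleton_self y))
  have hspan' : (⨆ i, L i) ⊔ Y' = V :=
    le_antisymm (sup_le (iSup_le hL) hY') (hspan ▸ sup_le_sup_left hlt.le _)
  obtain ⟨s, hs, c, hc, hsc⟩ := Submodule.mem_sup.1 (hspan.ge hy.1)
  obtain ⟨l, hl, rfl⟩ := (Submodule.mem_iSup_iff_exists_finsupp _ _).1 hs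
  set u₀ := homotopy (fun i => l i) z with hu₀
  have hu₀m : ∀ T, u₀ T ∈ piece L V (d + 1) T := homotopy_mem_piece hd hz hl
  have hzV : ∀ T, z T ∈ V ^ d := fun T => piece_le hL hd T (hz T)
  have hYmul : ∀ x ∈ Y, ∀ f ∈ V ^ d, x * f ∈ idealPart Y V (d + 1) :=
    fun x hx f hf => Submodule.mul_mem_mul hx hf
  have hbu₀ : ∀ T, y * z T - bdry R ι u₀ T ∈ idealPart Y V (d + 1) := by
    intro T
    have hsum : ∑ i, l i = l.sum fun _ x => x := by
      rw [Finsupp.sum_fintype]; simp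
    have h1 := bdry_homotopy_add (fun i => l i) z T
    have h2 : y * z T - bdry R ι u₀ T = c * z T + homotopy (fun i => l i) (bdry R ι z) T := by
      rw [← hsc, ← hsum]
      linear_combination -h1
    rw [h2]
    refine Submodule.add_mem _ (hYmul c hc _ (hzV T)) (Submodule.sum_mem _ fun i _ => ?_)
    exact koszulSign_mul_mem i T (mul_mem_idealPart (hL i (hl i)) (hbz _))
  have hysplit : ∀ x, x ∈ idealPart Y' V (d + 1) →
      ∃ f ∈ V ^ d, x - y * f ∈ idealPart Y V (d + 1) := by
    intro x hx
    rw [idealPart_sup] at hx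
    obtain ⟨p, hp, q, hq, rfl⟩ := Submodule.mem_sup.1 hx
    obtain ⟨f, hf, rfl⟩ := Submodule.mem_span_singleton_mul.1 hq
    exact ⟨f, hf, by simpa using hp⟩
  obtain ⟨w, hw, hw'⟩ := ih Y' hY' hlt hspan' (d + 1) (by omega) u₀ hu₀m (fun T => by
    have h1 : bdry R ι u₀ T = y * z T - (y * z T - bdry R ι u₀ T) := by ring
    rw [h1]
    refine Submodule.sub_mem _ ?_ (idealPart_mono le_sup_left _ _ (hbu₀ T))
    exact Submodule.mul_mem_mul (Submodule.mem_sup_right (Submodule.mem_span_singleton_self y))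
      (hzV T))
  choose f hfV hf using fun T => hysplit _ (hw' T)
  have hfm : ∀ T, f T ∈ piece L V d T ⊔ idealPart Y V d := by
    intro T
    have hT := T.card_le_univ
    have e1 : T.card + (d - T.card) = d := by omega
    have := mem_of_mul_mem_of_isGeneric hV hL Y hY y hy T (d - T.card) (f T)
      (by rw [e1]; exact hfV T) (by
        rw [e1]
        have h1 : y * f T = (u₀ T - bdry R ι w T) - (u₀ T - bdry R ι w T - y * f T) := by ring
        rw [h1]
        refine Submodule.sub_mem _ (Submodule.mem_sup_left ?_) (Submodule.mem_sup_right (hf T))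
        have h2 := Submodule.sub_mem _ (hu₀m T) (bdry_mem_piece hL (by omega) hw T)
        rw [piece] at h2
        convert h2 using 3
        omega)
    rwa [e1] at this
  choose u hu c' hc' huc using fun T => Submodule.mem_sup.1 (hfm T)
  refine ⟨u, hu, fun T => ?_⟩
  have hres : ∀ T, u₀ T - bdry R ι w T - y * u T ∈ idealPart Y V (d + 1) := by
    intro T
    have h1 : u₀ T - bdry R ι w T - y * u T = (u₀ T - bdry R ι w T - y * f T) + y * c' T := by
      rw [← huc]; ring
    rw [h1]
    exact Submodule.add_mem _ (hf T) (mul_mem_idealPart hy.1 (hc' T))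
  have hbres : bdry R ι u₀ T - y * bdry R ι u T ∈ idealPart Y V (d + 1) := by
    have h1 : bdry R ι (u₀ - bdry R ι w - y • u) T = bdry R ι u₀ T - y * bdry R ι u T := by
      rw [map_sub, map_sub, bdry_bdry, map_smul]; simp
    rw [← h1]
    exact Submodule.sum_mem _ fun i _ => koszulSign_mul_mem i T (hres _)
  have hfin : y * (z T - bdry R ι u T) ∈ idealPart Y V (d + 1) := by
    have h1 : y * (z T - bdry R ι u T) =
      (y * z T - bdry R ι u₀ T) + (bdry R ι u₀ T - y * bdry R ι u T) := by ring
    rw [h1]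
    exact Submodule.add_mem _ (hbu₀ T) hbres
  have := mem_of_mul_mem_of_notMem hV (L := fun _ : Unit => (⊥ : Submodule k R)) Finset.univ
    (by simp) hY hy.1 (by simpa using hyY) 0 d (f := z T - bdry R ι u T)
    (Submodule.mem_sup_right hfin)
  simpa using this

end Cube

theorem finrank_eq_of_exact {X : Type*} [AddCommGroup X] [Module k X] (δ : X →ₗ[k] X)
    {A B : Submodule k X} [FiniteDimensional k A] [FiniteDimensional k B]
    (hAB : ∀ x ∈ A, δ x ∈ B) (hBA : ∀ x ∈ B, δ x ∈ A) (hδ : ∀ x, δ (δ x) = 0)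
    (hA : ∀ x ∈ A, δ x = 0 → ∃ y ∈ B, δ y = x) (hB : ∀ x ∈ B, δ x = 0 → ∃ y ∈ A, δ y = x) :
    Module.finrank k A = Module.finrank k B := by
  let f : A →ₗ[k] B := δ.restrict hAB
  let g : B →ₗ[k] A := δ.restrict hBA
  have h1 : LinearMap.ker f = LinearMap.range g := by
    ext x
    constructor
    · intro hx
      obtain ⟨y, hy, hyx⟩ := hA x x.2 (congrArg Subtype.val (LinearMap.mem_ker.1 hx))
      exact ⟨⟨y, hy⟩, Subtype.ext hyx⟩
    · rintro ⟨y, rfl⟩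
      exact Subtype.ext (hδ y)
  have h2 : LinearMap.ker g = LinearMap.range f := by
    ext x
    constructor
    · intro hx
      obtain ⟨y, hy, hyx⟩ := hB x x.2 (congrArg Subtype.val (LinearMap.mem_ker.1 hx))
      exact ⟨⟨y, hy⟩, Subtype.ext hyx⟩
    · rintro ⟨y, rfl⟩
      exact Subtype.ext (hδ y)
  have h3 := LinearMap.finrank_range_add_finrank_ker f
  have h4 := LinearMap.finrank_range_add_finrank_ker g
  rw [h1] at h3
  rw [h2] at h4
  omega

/-- A product of subspaces, as a subspace of the product, is the product space. -/
def piUnivEquiv {ι : Type*} {E : Type*} [AddCommGroup E] [Module k E] (p : ι → Submodule k E) :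
    Submodule.pi Set.univ p ≃ₗ[k] (∀ i, p i) where
  toFun x i := ⟨x.1 i, x.2 i trivial⟩
  invFun x := ⟨fun i => x i, fun i _ => (x i).2⟩
  map_add' _ _ := rfl
  map_smul' _ _ := rfl

section Graded

variable {σ M : Type*} [AddCommMonoid M] {w : σ → M}

/-- A subspace of a polynomial ring spanned by weighted homogeneous elements. -/
def IsGraded (w : σ → M) (A : Submodule k (MvPolynomial σ k)) : Prop :=
  ∃ s : Set (MvPolynomial σ k), (∀ f ∈ s, ∃ m, IsWeightedHomogeneous w f m) ∧
    A = Submodule.span k s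

variable {A B : Submodule k (MvPolynomial σ k)}

open scoped Pointwise in
theorem IsGraded.mul (hA : IsGraded w A) (hB : IsGraded w B) : IsGraded w (A * B) := by
  obtain ⟨s, hs, rfl⟩ := hA
  obtain ⟨t, ht, rfl⟩ := hB
  refine ⟨s * t, ?_, Submodule.span_mul_span _ _ _⟩
  rintro _ ⟨f, hf, g, hg, rfl⟩
  obtain ⟨m, hm⟩ := hs f hf
  obtain ⟨m', hm'⟩ := ht g hg
  exact ⟨m + m', hm.mul hm'⟩

theorem isGraded_one : IsGraded w (1 : Submodule k (MvPolynomial σ k)) :=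
  ⟨{1}, by rintro _ rfl; exact ⟨0, isWeightedHomogeneous_one k w⟩, Submodule.one_eq_span⟩

theorem IsGraded.pow (hA : IsGraded w A) (n : ℕ) : IsGraded w (A ^ n) := by
  induction n with
  | zero => simpa using isGraded_one
  | succ n ih => rw [pow_succ]; exact ih.mul hA

theorem isGraded_prod {ι : Type*} {L : ι → Submodule k (MvPolynomial σ k)} (S : Finset ι)
    (hL : ∀ i, IsGraded w (L i)) : IsGraded w (∏ i ∈ S, L i) := by
  classical
  induction S using Finset.induction_on with
  | empty => simpa using isGraded_one
  | insert i S hi ih => rw [Finset.prod_insert hi]; exact (hL i).mul ih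

theorem IsGraded.sup (hA : IsGraded w A) (hB : IsGraded w B) : IsGraded w (A ⊔ B) := by
  obtain ⟨s, hs, rfl⟩ := hA
  obtain ⟨t, ht, rfl⟩ := hB
  refine ⟨s ∪ t, ?_, (Submodule.span_union _ _).symm⟩
  rintro f (hf | hf)
  exacts [hs f hf, ht f hf]

theorem isGraded_iSup {ι : Sort*} {L : ι → Submodule k (MvPolynomial σ k)}
    (hL : ∀ i, IsGraded w (L i)) : IsGraded w (⨆ i, L i) := by
  choose s hs hs' using hL
  refine ⟨⋃ i, s i, ?_, ?_⟩
  · intro f hf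
    obtain ⟨i, hi⟩ := Set.mem_iUnion.1 hf
    exact hs i f hi
  · rw [Submodule.span_iUnion]
    exact iSup_congr hs'

theorem isGraded_span_singleton {y : MvPolynomial σ k} {m : M}
    (hy : IsWeightedHomogeneous w y m) : IsGraded w (Submodule.span k {y}) :=
  ⟨{y}, by rintro _ rfl; exact ⟨m, hy⟩, rfl⟩

theorem IsGraded.component_mem (hA : IsGraded w A) (a : M) {f : MvPolynomial σ k} (hf : f ∈ A) :
    weightedHomogeneousComponent w a f ∈ A := by
  obtain ⟨s, hs, rfl⟩ := hA
  induction hf using Submodule.span_induction with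
  | mem x hx =>
    obtain ⟨m, hm⟩ := hs x hx
    by_cases h : a = m
    · rw [h, hm.weightedHomogeneousComponent_same]
      exact Submodule.subset_span hx
    · rw [hm.weightedHomogeneousComponent_ne a h]
      exact Submodule.zero_mem _
  | zero => simp
  | add x y _ _ h1 h2 => rw [map_add]; exact Submodule.add_mem _ h1 h2
  | smul c x _ h => rw [map_smul]; exact Submodule.smul_mem _ c h

theorem IsGraded.sup_inf (hA : IsGraded w A) (hB : IsGraded w B) (a : M) :
    (A ⊔ B) ⊓ weightedHomogeneousSubmodule k w a =
      (A ⊓ weightedHomogeneousSubmodule k w a) ⊔ (B ⊓ weightedHomogeneousSubmodule k w a) := by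
  refine le_antisymm ?_ (sup_le (inf_le_inf_right _ le_sup_left) (inf_le_inf_right _ le_sup_right))
  rintro f ⟨hf, hfa⟩
  obtain ⟨p, hp, q, hq, rfl⟩ := Submodule.mem_sup.1 hf
  have h := IsWeightedHomogeneous.weightedHomogeneousComponent_same
    ((mem_weightedHomogeneousSubmodule k w a _).1 hfa)
  rw [← h, map_add]
  exact Submodule.add_mem _
    (Submodule.mem_sup_left ⟨hA.component_mem a hp, weightedHomogeneousComponent_mem w p a⟩)
    (Submodule.mem_sup_right ⟨hB.component_mem a hq, weightedHomogeneousComponent_mem w q a⟩)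

/-- The dimension of the part of weight `a` of a space of polynomials. -/
def gradedDim (w : σ → M) (A : Submodule k (MvPolynomial σ k)) (a : M) : ℕ :=
  Module.finrank k (A ⊓ weightedHomogeneousSubmodule k w a : Submodule k (MvPolynomial σ k))

theorem gradedDim_sup (hA : IsGraded w A) (hB : IsGraded w B) (hAf : A.FG) (hBf : B.FG)
    (hAB : A ⊓ B = ⊥) (a : M) : gradedDim w (A ⊔ B) a = gradedDim w A a + gradedDim w B a := by
  have : FiniteDimensional k A := Module.Finite.iff_fg.2 hAf
  have : FiniteDimensional k B := Module.Finite.iff_fg.2 hBf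
  have h1 : FiniteDimensional k (A ⊓ weightedHomogeneousSubmodule k w a :
    Submodule k (MvPolynomial σ k)) := Submodule.finiteDimensional_of_le inf_le_left
  have h2 : FiniteDimensional k (B ⊓ weightedHomogeneousSubmodule k w a :
    Submodule k (MvPolynomial σ k)) := Submodule.finiteDimensional_of_le inf_le_left
  have h3 := Submodule.finrank_sup_add_finrank_inf_eq (A ⊓ weightedHomogeneousSubmodule k w a)
    (B ⊓ weightedHomogeneousSubmodule k w a)
  have h4 : (A ⊓ weightedHomogeneousSubmodule k w a) ⊓ (B ⊓ weightedHomogeneousSubmodule k w a)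
      = ⊥ := le_bot_iff.1 (le_trans (inf_le_inf inf_le_left inf_le_left) hAB.le)
  rw [h4, finrank_bot, add_zero] at h3
  rw [gradedDim, hA.sup_inf hB, h3]
  rfl

theorem exists_bdry_eq_of_isWeightedHomogeneous [Infinite k] {ι : Type*} [LinearOrder ι]
    [Fintype ι] [Nonempty ι] {L : ι → Submodule k (MvPolynomial σ k)}
    {V : Submodule k (MvPolynomial σ k)} [FiniteDimensional k V] (hV : HasRetractions V)
    (hL : ⨆ i, L i = V) (hg : ∀ i, IsGraded w (L i)) {d : ℕ} (hd : Fintype.card ι ≤ d) (a : M)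
    {z : Finset ι → MvPolynomial σ k}
    (hz : ∀ T, z T ∈ piece L V d T ⊓ weightedHomogeneousSubmodule k w a)
    (hbz : bdry (MvPolynomial σ k) ι z = 0) :
    ∃ u : Finset ι → MvPolynomial σ k,
      (∀ T, u T ∈ piece L V d T ⊓ weightedHomogeneousSubmodule k w a) ∧
      bdry (MvPolynomial σ k) ι u = z := by
  have hVg : IsGraded w V := hL ▸ isGraded_iSup hg
  obtain ⟨u, hu, hzu⟩ := exists_sub_bdry_mem hV (fun i => hL ▸ le_iSup L i) ⊥ bot_le
    (by rw [hL, sup_bot_eq]) d hd z (fun T => (hz T).1) (by simp [hbz])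
  have hbot : idealPart (⊥ : Submodule k (MvPolynomial σ k)) V d = ⊥ := by
    cases d <;> simp [idealPart]
  refine ⟨fun T => weightedHomogeneousComponent w a (u T), fun T =>
    ⟨((isGraded_prod T hg).mul (hVg.pow _)).component_mem a (hu T),
      weightedHomogeneousComponent_mem w _ a⟩, ?_⟩
  ext1 T
  have h1 : z T = bdry _ ι u T := by
    have := hzu T
    rwa [hbot, Submodule.mem_bot, sub_eq_zero] at this
  have h2 := IsWeightedHomogeneous.weightedHomogeneousComponent_same
    ((mem_weightedHomogeneousSubmodule k w a _).1 (hz T).2)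
  rw [← h2, h1, bdry_apply, bdry_apply, map_sum]
  refine Finset.sum_congr rfl fun i _ => ?_
  rcases neg_one_pow_eq_or (MvPolynomial σ k) (T.filter (· < i)).card with h | h <;>
    simp [koszulSign, h]

/-- The Euler characteristic of the graded cube complex vanishes. -/
theorem sum_neg_one_pow_card_mul_gradedDim [Infinite k] {ι : Type*} [Fintype ι] [Nonempty ι]
    {L : ι → Submodule k (MvPolynomial σ k)} {V : Submodule k (MvPolynomial σ k)}
    [FiniteDimensional k V] (hV : HasRetractions V) (hL : ⨆ i, L i = V)
    (hg : ∀ i, IsGraded w (L i)) {d : ℕ} (hd : Fintype.card ι ≤ d) (a : M) :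
    ∑ T : Finset ι, (-1 : ℤ) ^ T.card * gradedDim w (piece L V d T) a = 0 := by
  classical
  let : LinearOrder ι := LinearOrder.lift' (Fintype.equivFin ι) (Fintype.equivFin ι).injective
  have hLV : ∀ i, L i ≤ V := fun i => hL ▸ le_iSup L i
  let D : Finset ι → Submodule k (MvPolynomial σ k) :=
    fun T => piece L V d T ⊓ weightedHomogeneousSubmodule k w a
  let E : Bool → Finset ι → Submodule k (MvPolynomial σ k) :=
    fun b T => if decide (Even T.card) = b then D T else ⊥
  let Q : Bool → Submodule k (Finset ι → MvPolynomial σ k) := fun b => Submodule.pi Set.univ (E b)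
  have hVd : (V ^ d).FG := (Module.Finite.iff_fg.1 ‹FiniteDimensional k V›).pow d
  have : FiniteDimensional k (V ^ d : Submodule k (MvPolynomial σ k)) := Module.Finite.iff_fg.2 hVd
  have hfin : ∀ b T, FiniteDimensional k (E b T) := by
    intro b T
    refine Submodule.finiteDimensional_of_le (S₂ := V ^ d) ?_
    simp only [E]
    split_ifs
    · exact inf_le_left.trans (piece_le hLV hd T)
    · exact bot_le
  have hfinQ : ∀ b, FiniteDimensional k (Q b) := fun b =>
    LinearEquiv.finiteDimensional (piUnivEquiv (E b)).symm
  have hrank : ∀ b, Module.finrank k (Q b) = ∑ T, Module.finrank k (E b T) := fun b => by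
    rw [(piUnivEquiv (E b)).finrank_eq, Module.finrank_pi_fintype]
  let δ : (Finset ι → MvPolynomial σ k) →ₗ[k] (Finset ι → MvPolynomial σ k) :=
    (bdry (MvPolynomial σ k) ι).restrictScalars k
  have hQD : ∀ b, ∀ x ∈ Q b, ∀ T, x T ∈ D T := by
    intro b x hx T
    have := hx T trivial
    simp only [E] at this
    split_ifs at this
    · exact this
    · rw [(Submodule.mem_bot k).1 this]; exact Submodule.zero_mem _
  have hQ0 : ∀ b, ∀ x ∈ Q b, ∀ T : Finset ι, decide (Even T.card) ≠ b → x T = 0 := by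
    intro b x hx T hT
    have := hx T trivial
    simp only [E] at this
    rw [if_neg hT] at this
    exact (Submodule.mem_bot k).1 this
  have hpar : ∀ (T : Finset ι) (i : ι), i ∈ Tᶜ →
      decide (Even (insert i T).card) = !decide (Even T.card) := by
    intro T i hi
    simp only [Finset.card_insert_of_notMem (Finset.mem_compl.1 hi), Nat.even_add_one, decide_not]
  have hD : ∀ z, (∀ T, z T ∈ D T) → ∀ T, δ z T ∈ D T := by
    intro z hz T
    exact ⟨bdry_mem_piece hLV hd (fun T => (hz T).1) T, Submodule.sum_mem _ fun i _ =>
      koszulSign_mul_mem i T (hz _).2⟩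
  have hδQ : ∀ b, ∀ x ∈ Q b, δ x ∈ Q (!b) := by
    intro b x hx T _
    simp only [E]
    split_ifs with h
    · exact hD x (hQD b x hx) T
    · refine (Submodule.mem_bot k).2 (Finset.sum_eq_zero fun i hi => ?_)
      rw [hQ0 b x hx _ ?_, mul_zero]
      rw [hpar T i hi]
      intro h'
      exact h (by rw [← h', Bool.not_not])
  have hex : ∀ b, ∀ x ∈ Q b, δ x = 0 → ∃ y ∈ Q (!b), δ y = x := by
    intro b x hx h0
    obtain ⟨u, hu, hux⟩ := exists_bdry_eq_of_isWeightedHomogeneous hV hL hg hd a (hQD b x hx) h0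
    refine ⟨fun T => if decide (Even T.card) = !b then u T else 0, ?_, ?_⟩
    · intro T _
      simp only [E]
      split_ifs
      · exact hu T
      · exact Submodule.zero_mem _
    · ext1 T
      change bdry _ ι _ T = x T
      by_cases h : decide (Even T.card) = b
      · rw [← hux, bdry_apply, bdry_apply]
        refine Finset.sum_congr rfl fun i hi => ?_
        rw [if_pos (by rw [hpar T i hi, h])]
      · rw [hQ0 b x hx T h, bdry_apply]
        refine Finset.sum_eq_zero fun i hi => ?_
        rw [if_neg, mul_zero]
        rw [hpar T i hi]
        intro h'
        exact h (by simpa using h')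
  have hmain : Module.finrank k (Q true) = Module.finrank k (Q false) :=
    finrank_eq_of_exact δ (hδQ true) (hδQ false) (fun x => bdry_bdry x) (hex true) (hex false)
  rw [hrank, hrank] at hmain
  have hterm : ∀ T : Finset ι, (-1 : ℤ) ^ T.card * gradedDim w (piece L V d T) a =
      (Module.finrank k (E true T) : ℤ) - Module.finrank k (E false T) := by
    intro T
    by_cases h : Even T.card
    · have h1 : E true T = D T := if_pos (by simp [h])
      have h2 : E false T = ⊥ := if_neg (by simp [h])
      rw [h1, h2, finrank_bot, h.neg_one_pow]
      simp [D, gradedDim]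
    · have h1 : E true T = ⊥ := if_neg (by simp [h])
      have h2 : E false T = D T := if_pos (by simp [h])
      rw [h1, h2, finrank_bot, (Nat.not_even_iff_odd.1 h).neg_one_pow]
      simp [D, gradedDim]
  rw [Finset.sum_congr rfl fun T _ => hterm T, Finset.sum_sub_distrib, sub_eq_zero]
  exact_mod_cast hmain

theorem IsGraded.component_mul [IsLeftCancelAdd M] (hA : IsGraded w A) {y : MvPolynomial σ k}
    {m : M} (hy : IsWeightedHomogeneous w y m) (a : M) {f : MvPolynomial σ k} (hf : f ∈ A) :
    weightedHomogeneousComponent w (m + a) (y * f) = y * weightedHomogeneousComponent w a f := by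
  obtain ⟨s, hs, rfl⟩ := hA
  induction hf using Submodule.span_induction with
  | mem x hx =>
    obtain ⟨c, hc⟩ := hs x hx
    by_cases h : a = c
    · rw [h, hc.weightedHomogeneousComponent_same, (hy.mul hc).weightedHomogeneousComponent_same]
    · rw [hc.weightedHomogeneousComponent_ne a h, (hy.mul hc).weightedHomogeneousComponent_ne _
        fun h' => h (add_left_cancel h'), mul_zero]
  | zero => simp
  | add x y _ _ h1 h2 => rw [mul_add, map_add, h1, h2, map_add, mul_add]
  | smul c x _ h => rw [mul_smul_comm, map_smul, h, map_smul, mul_smul_comm]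

theorem gradedDim_span_mul [IsLeftCancelAdd M] (hA : IsGraded w A) {y : MvPolynomial σ k} {m : M}
    (hy : IsWeightedHomogeneous w y m) (hy0 : y ≠ 0) (a : M) :
    gradedDim w (Submodule.span k {y} * A) (m + a) = gradedDim w A a := by
  have hinj : Function.Injective (LinearMap.mulLeft k y) := fun p q h => mul_left_cancel₀ hy0 h
  have key : Submodule.span k {y} * A ⊓ weightedHomogeneousSubmodule k w (m + a) =
      (A ⊓ weightedHomogeneousSubmodule k w a).map (LinearMap.mulLeft k y) := by
    ext f
    constructor
    · rintro ⟨hf, hfa⟩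
      obtain ⟨q, hq, rfl⟩ := Submodule.mem_span_singleton_mul.1 hf
      refine ⟨weightedHomogeneousComponent w a q, ⟨hA.component_mem a hq,
        weightedHomogeneousComponent_mem w q a⟩, ?_⟩
      rw [LinearMap.mulLeft_apply, ← hA.component_mul hy a hq]
      exact IsWeightedHomogeneous.weightedHomogeneousComponent_same hfa
    · rintro ⟨q, ⟨hq, hqa⟩, rfl⟩
      exact ⟨Submodule.mem_span_singleton_mul.2 ⟨q, hq, rfl⟩, hy.mul hqa⟩
  rw [gradedDim, gradedDim, key]
  exact (Submodule.equivMapOfInjective _ hinj _).finrank_eq.symm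

theorem gradedDim_span_mul_eq_zero (hA : IsGraded w A) {y : MvPolynomial σ k} {m : M}
    (hy : IsWeightedHomogeneous w y m) {a : M} (ha : ∀ c, a ≠ m + c) :
    gradedDim w (Submodule.span k {y} * A) a = 0 := by
  suffices key : Submodule.span k {y} * A ⊓ weightedHomogeneousSubmodule k w a = ⊥ by
    rw [gradedDim, key, finrank_bot]
  rw [eq_bot_iff]
  rintro f ⟨hf, hfa⟩
  rw [Submodule.mem_bot, ← IsWeightedHomogeneous.weightedHomogeneousComponent_same hfa]
  obtain ⟨q, hq, rfl⟩ := Submodule.mem_span_singleton_mul.1 hf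
  clear hf hfa
  obtain ⟨s, hs, rfl⟩ := hA
  induction hq using Submodule.span_induction with
  | mem x hx =>
    obtain ⟨c, hc⟩ := hs x hx
    exact (hy.mul hc).weightedHomogeneousComponent_ne _ (ha c)
  | zero => simp
  | add x y _ _ h1 h2 => rw [mul_add, map_add, h1, h2, add_zero]
  | smul c x _ h => rw [mul_smul_comm, map_smul, h, smul_zero]

end Graded

theorem hasRetractions_of_le_span_range_X {σ : Type*} {V : Submodule k (MvPolynomial σ k)}
    (hV : V ≤ Submodule.span k (Set.range X)) : HasRetractions V := by
  intro W hW y hy hyW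
  obtain ⟨Φ₀, hΦ₀, hWΦ₀⟩ := Submodule.exists_le_ker_of_notMem hyW
  obtain ⟨Φ, hΦ, hWΦ⟩ : ∃ Φ : MvPolynomial σ k →ₗ[k] k, Φ y = 1 ∧ W ≤ LinearMap.ker Φ :=
    ⟨(Φ₀ y)⁻¹ • Φ₀, by simp [hΦ₀], fun x hx => by simp [LinearMap.mem_ker.1 (hWΦ₀ hx)]⟩
  let θ : MvPolynomial σ k →ₐ[k] MvPolynomial σ k := aeval fun i => X i - Φ (X i) • y
  have hθ : ∀ x ∈ V, θ x = x - Φ x • y := by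
    intro x hx
    replace hx := hV hx
    induction hx using Submodule.span_induction with
    | mem x h => obtain ⟨i, rfl⟩ := h; simp [θ]
    | zero => simp
    | add p q _ _ h1 h2 => rw [map_add, map_add, h1, h2, add_smul]; ring
    | smul c p _ h => rw [map_smul, map_smul, h, smul_sub, smul_eq_mul, mul_smul]
  refine ⟨θ, V ⊓ LinearMap.ker Φ, le_inf hW hWΦ, inf_le_left, ?_, ?_, ?_⟩
  · intro x hx
    refine Submodule.mem_sup.2 ⟨x - Φ x • y, ⟨V.sub_mem hx (V.smul_mem _ hy), ?_⟩, Φ x • y,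
      Submodule.smul_mem _ _ (Submodule.mem_span_singleton_self y), by simp⟩
    simp [hΦ]
  · intro x hx
    rw [hθ x hx.1, LinearMap.mem_ker.1 hx.2, zero_smul, sub_zero]
  · rw [hθ y hy, hΦ, one_smul, sub_self]

section Extension

variable {σ M : Type*} [AddCommMonoid M] {w : σ → M} {m : M}

/-- The space `V` of linear forms can be extended by the form `y` of weight `m`, in the presence
of the factor `P`. -/
structure IsExtension (w : σ → M) (m : M) (P V : Submodule k (MvPolynomial σ k))
    (y : MvPolynomial σ k) : Prop where
  le_span : V ⊔ Submodule.span k {y} ≤ Submodule.span k (Set.range X)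
  notMem : y ∉ V
  fixes : ∀ θ : MvPolynomial σ k →ₐ[k] MvPolynomial σ k, (∀ x ∈ V, θ x = x) → ∀ x ∈ P, θ x = x
  isGraded_left : IsGraded w P
  isGraded_right : IsGraded w V
  isWeightedHomogeneous : IsWeightedHomogeneous w y m
  fg_left : P.FG
  fg_right : V.FG

variable {P V P₁ V₁ P₂ V₂ : Submodule k (MvPolynomial σ k)} {y y₁ y₂ : MvPolynomial σ k}

theorem IsExtension.gradedDim_pow_succ (h : IsExtension w m P V y) (e : ℕ) (a : M) :
    gradedDim w (P * (V ⊔ Submodule.span k {y}) ^ (e + 1)) a =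
      gradedDim w (P * V ^ (e + 1)) a +
        gradedDim w (Submodule.span k {y} * (P * (V ⊔ Submodule.span k {y}) ^ e)) a := by
  have hy : y ∈ V ⊔ Submodule.span k {y} :=
    Submodule.mem_sup_right (Submodule.mem_span_singleton_self y)
  obtain ⟨θ, V', hVV', -, -, hθ, hθy⟩ :=
    hasRetractions_of_le_span_range_X h.le_span V le_sup_left y hy h.notMem
  have hθV : ∀ x ∈ V, θ x = x := fun x hx => hθ x (hVV' hx)
  have hyg := isGraded_span_singleton (k := k) h.isWeightedHomogeneous
  have hsg := h.isGraded_right.sup hyg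
  have hsf := h.fg_right.sup (Submodule.fg_span_singleton y)
  have heq : P * (V ⊔ Submodule.span k {y}) ^ (e + 1) = P * V ^ (e + 1) ⊔
      Submodule.span k {y} * (P * (V ⊔ Submodule.span k {y}) ^ e) := by
    rw [mul_left_comm, ← Submodule.mul_sup]
    congr 1
    refine le_antisymm (pow_succ_le_of_le_sup le_sup_left hy le_rfl e)
      (sup_le (pow_le_pow_left' le_sup_left _) ?_)
    rw [pow_succ']
    exact mul_le_mul_left le_sup_right _
  rw [heq]
  refine gradedDim_sup (h.isGraded_left.mul (h.isGraded_right.pow _))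
    (hyg.mul (h.isGraded_left.mul (hsg.pow _))) (h.fg_left.mul (h.fg_right.pow _))
    ((Submodule.fg_span_singleton y).mul (h.fg_left.mul (hsf.pow _))) ?_ a
  rw [eq_bot_iff]
  rintro x ⟨hx1, hx2⟩
  obtain ⟨q, -, rfl⟩ := Submodule.mem_span_singleton_mul.1 hx2
  rw [Submodule.mem_bot, ← algHom_fixes_mul (h.fixes θ hθV) (algHom_fixes_pow hθV _) _ hx1,
    map_mul, hθy, zero_mul]

theorem IsExtension.gradedDim_congr [IsLeftCancelAdd M] (h₁ : IsExtension w m P₁ V₁ y₁)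
    (h₂ : IsExtension w m P₂ V₂ y₂)
    (h : ∀ e a, gradedDim w (P₁ * V₁ ^ e) a = gradedDim w (P₂ * V₂ ^ e) a) (e : ℕ) (a : M) :
    gradedDim w (P₁ * (V₁ ⊔ Submodule.span k {y₁}) ^ e) a =
      gradedDim w (P₂ * (V₂ ⊔ Submodule.span k {y₂}) ^ e) a := by
  have hg : ∀ {P V y}, IsExtension w m P V y → ∀ e : ℕ,
      IsGraded w (P * (V ⊔ Submodule.span k {y}) ^ e) ∧ y ≠ 0 := fun h e =>
    ⟨h.isGraded_left.mul ((h.isGraded_right.sup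
      (isGraded_span_singleton h.isWeightedHomogeneous)).pow e),
      fun h0 => h.notMem (h0 ▸ Submodule.zero_mem _)⟩
  induction e generalizing a with
  | zero => simpa using h 0 a
  | succ e ih =>
    rw [h₁.gradedDim_pow_succ, h₂.gradedDim_pow_succ, h]
    congr 1
    by_cases ha : ∃ c, a = m + c
    · obtain ⟨c, rfl⟩ := ha
      rw [gradedDim_span_mul (hg h₁ e).1 h₁.isWeightedHomogeneous (hg h₁ e).2,
        gradedDim_span_mul (hg h₂ e).1 h₂.isWeightedHomogeneous (hg h₂ e).2, ih]
    · have ha := not_exists.1 ha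
      rw [gradedDim_span_mul_eq_zero (hg h₁ e).1 h₁.isWeightedHomogeneous ha,
        gradedDim_span_mul_eq_zero (hg h₂ e).1 h₂.isWeightedHomogeneous ha]

end Extension

theorem fg_prod {ι : Type*} {L : ι → Submodule k R} (S : Finset ι) (hL : ∀ i, (L i).FG) :
    (∏ i ∈ S, L i).FG := by
  classical
  induction S using Finset.induction_on with
  | empty => rw [Finset.prod_empty, Submodule.one_eq_span]; exact Submodule.fg_span_singleton 1
  | insert i S hi ih => rw [Finset.prod_insert hi]; exact (hL i).mul ih

section Vectors

variable {r : ℕ}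

/-- The `l`-th coordinate of the image of a vector under the generic square matrix. -/
def linForm (l : Fin r) : (Fin r → k) →ₗ[k] MvPolynomial (Fin r × Fin r) k :=
  ∑ c, (LinearMap.proj c).smulRight (X (l, c))

theorem linForm_apply (l : Fin r) (u : Fin r → k) :
    linForm l u = ∑ c, u c • (X (l, c) : MvPolynomial (Fin r × Fin r) k) := by
  simp [linForm]

/-- The row weight of the entries of the generic square matrix. -/
def rowWeight (r : ℕ) (p : Fin r × Fin r) : Fin r → ℕ := Pi.single p.1 1

/-- The span of the coordinates of the image of a vector under the generic square matrix. -/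
def formSpace (u : Fin r → k) : Submodule k (MvPolynomial (Fin r × Fin r) k) :=
  ⨆ l, Submodule.span k {linForm l u}

theorem isWeightedHomogeneous_linForm (l : Fin r) (u : Fin r → k) :
    IsWeightedHomogeneous (rowWeight r) (linForm l u) (Pi.single l 1) := by
  rw [linForm_apply]
  exact Submodule.sum_mem (weightedHomogeneousSubmodule k (rowWeight r) _) fun c _ =>
    Submodule.smul_mem _ _ (isWeightedHomogeneous_X k (rowWeight r) (l, c))

theorem isGraded_formSpace (u : Fin r → k) : IsGraded (rowWeight r) (formSpace u) :=
  isGraded_iSup fun l => isGraded_span_singleton (isWeightedHomogeneous_linForm l u)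

theorem fg_formSpace (u : Fin r → k) : (formSpace u).FG :=
  Submodule.fg_iSup _ fun _ => Submodule.fg_span_singleton _

theorem span_linForm_le (l : Fin r) (u : Fin r → k) :
    Submodule.span k {linForm l u} ≤ Submodule.span k (Set.range X) := by
  rw [Submodule.span_singleton_le_iff_mem, linForm_apply]
  exact Submodule.sum_mem _ fun c _ =>
    Submodule.smul_mem _ _ (Submodule.subset_span (Set.mem_range_self _))

theorem formSpace_le (u : Fin r → k) : formSpace u ≤ Submodule.span k (Set.range X) :=
  iSup_le fun l => span_linForm_le l u

theorem formSpace_le_iSup {ι : Type*} {v : ι → Fin r → k} {T : Finset ι} {u : Fin r → k}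
    (hu : u ∈ Submodule.span k (v '' T)) : formSpace u ≤ ⨆ i ∈ T, formSpace (v i) := by
  refine iSup_le fun l => (Submodule.span_singleton_le_iff_mem _ _).2 ?_
  suffices Submodule.span k (v '' T) ≤ (⨆ i ∈ T, formSpace (v i)).comap (linForm l) from this hu
  rw [Submodule.span_le]
  rintro _ ⟨i, hi, rfl⟩
  exact Submodule.mem_iSup_of_mem i (Submodule.mem_iSup_of_mem hi
    (Submodule.mem_iSup_of_mem l (Submodule.mem_span_singleton_self _)))

theorem linForm_notMem {ι : Type*} {v : ι → Fin r → k} {T : Finset ι} {u : Fin r → k}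
    (hu : u ∉ Submodule.span k (v '' T)) {C : Finset (Fin r)} {m : Fin r} (hm : m ∉ C) :
    linForm m u ∉ (⨆ i ∈ T, formSpace (v i)) ⊔ ⨆ l ∈ C, Submodule.span k {linForm l u} := by
  obtain ⟨φ, hφ, hTφ⟩ := Submodule.exists_le_ker_of_notMem hu
  let Ψ : MvPolynomial (Fin r × Fin r) k →ₐ[k] k :=
    aeval fun p => if p.1 = m then φ (Pi.single p.2 1) else 0
  have hΨ : ∀ l x, Ψ (linForm l x) = if l = m then φ x else 0 := by
    intro l x
    rw [linForm_apply, map_sum]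
    by_cases h : l = m
    · rw [if_pos h]
      conv_rhs => rw [pi_eq_sum_univ' x, map_sum]
      refine Finset.sum_congr rfl fun c _ => ?_
      rw [map_smul, map_smul]
      congr 1
      simp only [Ψ, aeval_X, if_pos h]
    · simp [Ψ, h]
  intro h
  have hle : (⨆ i ∈ T, formSpace (v i)) ⊔ ⨆ l ∈ C, Submodule.span k {linForm l u} ≤
      LinearMap.ker Ψ.toLinearMap := by
    refine sup_le (iSup₂_le fun i hi => iSup_le fun l => ?_) (iSup₂_le fun l hl => ?_) <;>
      rw [Submodule.span_singleton_le_iff_mem, LinearMap.mem_ker, AlgHom.toLinearMap_apply, hΨ]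
    · rw [LinearMap.mem_ker.1 (hTφ (Submodule.subset_span (Set.mem_image_of_mem v hi))), ite_self]
    · exact if_neg (by rintro rfl; exact hm hl)
  have := hle h
  rw [LinearMap.mem_ker, AlgHom.toLinearMap_apply, hΨ, if_pos rfl] at this
  exact hφ this

variable {ι : Type*} {v w : ι → Fin r → k}

theorem isExtension_formSpace {T B : Finset ι} (hTB : T ⊆ B) {u : Fin r → k}
    (hu : u ∉ Submodule.span k (v '' B)) {C : Finset (Fin r)} {m : Fin r} (hm : m ∉ C) :
    IsExtension (rowWeight r) (Pi.single m 1) (∏ i ∈ T, formSpace (v i))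
      ((⨆ i ∈ B, formSpace (v i)) ⊔ ⨆ l ∈ C, Submodule.span k {linForm l u}) (linForm m u) where
  le_span := sup_le (sup_le (iSup₂_le fun _ _ => formSpace_le _)
    (iSup₂_le fun l _ => span_linForm_le l u)) (span_linForm_le m u)
  notMem := linForm_notMem hu hm
  fixes _ hθ := algHom_fixes_prod T fun i hi x hx => hθ x (Submodule.mem_sup_left
    (Submodule.mem_iSup_of_mem i (Submodule.mem_iSup_of_mem (hTB hi) hx)))
  isGraded_left := isGraded_prod T fun _ => isGraded_formSpace _
  isGraded_right := (isGraded_iSup fun _ => isGraded_iSup fun _ => isGraded_formSpace _).sup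
    (isGraded_iSup fun l => isGraded_iSup fun _ =>
      isGraded_span_singleton (isWeightedHomogeneous_linForm l u))
  isWeightedHomogeneous := isWeightedHomogeneous_linForm m u
  fg_left := fg_prod T fun _ => fg_formSpace _
  fg_right := (Submodule.fg_biSup _ _ fun _ _ => fg_formSpace _).sup
    (Submodule.fg_biSup _ _ fun _ _ => Submodule.fg_span_singleton _)

/-- The dimensions of the graded pieces of `∏ i ∈ T, formSpace (v i) * V ^ e`, for `V` the sum of
the spaces attached to the members of `B ⊇ T`, depend only on those for `B = T`. -/
theorem gradedDim_prod_mul_pow_congr [DecidableEq ι]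
    (hvw : ∀ (T : Finset ι) (j : ι),
      v j ∈ Submodule.span k (v '' T) ↔ w j ∈ Submodule.span k (w '' T)) {T : Finset ι}
    (hT : ∀ e a,
      gradedDim (rowWeight r) ((∏ i ∈ T, formSpace (v i)) * (⨆ i ∈ T, formSpace (v i)) ^ e) a =
      gradedDim (rowWeight r) ((∏ i ∈ T, formSpace (w i)) * (⨆ i ∈ T, formSpace (w i)) ^ e) a)
    (A : Finset ι) (e : ℕ) (a : Fin r → ℕ) :
    gradedDim (rowWeight r)
      ((∏ i ∈ T, formSpace (v i)) * (⨆ i ∈ T ∪ A, formSpace (v i)) ^ e) a =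
    gradedDim (rowWeight r)
      ((∏ i ∈ T, formSpace (w i)) * (⨆ i ∈ T ∪ A, formSpace (w i)) ^ e) a := by
  induction A using Finset.induction_on generalizing e a with
  | empty => simpa using hT e a
  | insert j A _ ih =>
    rw [Finset.union_insert, Finset.iSup_insert, Finset.iSup_insert]
    by_cases hj : v j ∈ Submodule.span k (v '' (T ∪ A : Finset ι))
    · rw [sup_eq_right.2 (formSpace_le_iSup hj),
        sup_eq_right.2 (formSpace_le_iSup ((hvw _ _).1 hj)), ih]
    · have hj' := fun h => hj ((hvw (T ∪ A) j).2 h)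
      suffices ∀ (C : Finset (Fin r)) (e a), gradedDim (rowWeight r)
          ((∏ i ∈ T, formSpace (v i)) * ((⨆ i ∈ T ∪ A, formSpace (v i)) ⊔
            ⨆ l ∈ C, Submodule.span k {linForm l (v j)}) ^ e) a =
          gradedDim (rowWeight r)
          ((∏ i ∈ T, formSpace (w i)) * ((⨆ i ∈ T ∪ A, formSpace (w i)) ⊔
            ⨆ l ∈ C, Submodule.span k {linForm l (w j)}) ^ e) a by
        have := this Finset.univ e a
        simp only [Finset.mem_univ, iSup_pos] at this
        rwa [sup_comm, sup_comm (formSpace (w j))]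
      intro C
      induction C using Finset.induction_on with
      | empty => simpa using ih
      | insert m C hm ihC =>
        intro e a
        rw [Finset.iSup_insert, Finset.iSup_insert, sup_comm (Submodule.span k _), ← sup_assoc,
          sup_comm (Submodule.span k _), ← sup_assoc]
        exact (isExtension_formSpace Finset.subset_union_left hj hm).gradedDim_congr
          (isExtension_formSpace Finset.subset_union_left hj' hm) ihC e a

theorem sum_gradedDim_prod_mul_pow [Infinite k] (v : ι → Fin r → k) {T : Finset ι}
    (hT : T.Nonempty) (e : ℕ) (a : Fin r → ℕ) :
    ∑ S : Finset T, (-1 : ℤ) ^ S.card * gradedDim (rowWeight r)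
      ((∏ i ∈ S.map (Function.Embedding.subtype _), formSpace (v i)) *
        (⨆ i ∈ T, formSpace (v i)) ^ (T.card + e - S.card)) a = 0 := by
  have : Nonempty T := hT.to_subtype
  have hV : (⨆ i ∈ T, formSpace (v i)) = ⨆ i : T, formSpace (v i) := iSup_subtype'
  rw [hV]
  have : FiniteDimensional k (⨆ i : T, formSpace (v i) : Submodule k _) :=
    Module.Finite.iff_fg.2 (Submodule.fg_iSup _ fun _ => fg_formSpace _)
  have h := sum_neg_one_pow_card_mul_gradedDim (w := rowWeight r)
    (hasRetractions_of_le_span_range_X (iSup_le fun i : T => formSpace_le (v i))) rfl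
    (fun i => isGraded_formSpace _) (d := T.card + e) (by simp) a
  simpa only [piece, Finset.prod_map, Function.Embedding.subtype_apply] using h

theorem gradedDim_prod_mul_pow_eq [Infinite k]
    (hvw : ∀ (T : Finset ι) (j : ι),
      v j ∈ Submodule.span k (v '' T) ↔ w j ∈ Submodule.span k (w '' T)) (T : Finset ι) :
    ∀ e a,
      gradedDim (rowWeight r) ((∏ i ∈ T, formSpace (v i)) * (⨆ i ∈ T, formSpace (v i)) ^ e) a =
      gradedDim (rowWeight r) ((∏ i ∈ T, formSpace (w i)) * (⨆ i ∈ T, formSpace (w i)) ^ e) a := by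
  classical
  induction T using Finset.strongInduction with
  | H T ih =>
    intro e a
    rcases T.eq_empty_or_nonempty with rfl | hT
    · simp
    have h := (sum_gradedDim_prod_mul_pow v hT e a).trans (sum_gradedDim_prod_mul_pow w hT e a).symm
    rw [← sub_eq_zero, ← Finset.sum_sub_distrib, Finset.sum_eq_single Finset.univ] at h
    · have hu : (Finset.univ : Finset T).map (Function.Embedding.subtype _) = T := by
        ext; simp
      rw [hu, Finset.card_univ, Fintype.card_coe, add_tsub_cancel_left, ← mul_sub] at h
      have h' := (mul_eq_zero.1 h).resolve_left (by simp)
      exact_mod_cast sub_eq_zero.1 h'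
    · intro S _ hS
      have hlt : S.map (Function.Embedding.subtype _) ⊂ T := by
        refine Finset.ssubset_iff_subset_ne.2 ⟨?_, fun h => hS ?_⟩
        · intro i hi
          obtain ⟨j, -, rfl⟩ := Finset.mem_map.1 hi
          exact j.2
        · refine Finset.eq_univ_of_card _ ?_
          rw [← Finset.card_map (Function.Embedding.subtype _), h, Fintype.card_coe]
      have := gradedDim_prod_mul_pow_congr hvw (ih _ hlt) T (T.card + e - S.card) a
      rw [Finset.union_eq_right.2 hlt.1] at this
      rw [this, sub_self]
    · simp

theorem gradedDim_prod_eq [Infinite k] [Fintype ι]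
    (hvw : ∀ (T : Finset ι) (j : ι),
      v j ∈ Submodule.span k (v '' T) ↔ w j ∈ Submodule.span k (w '' T)) (a : Fin r → ℕ) :
    gradedDim (rowWeight r) (∏ i, formSpace (v i)) a =
      gradedDim (rowWeight r) (∏ i, formSpace (w i)) a := by
  simpa using gradedDim_prod_mul_pow_eq hvw Finset.univ 0 a

end Vectors

theorem mem_span_image_of_linearIndepOn {J : Type*} {E E' : Type*} [AddCommGroup E] [Module k E]
    [AddCommGroup E'] [Module k E'] {v : J → E} {w : J → E'}
    (h : ∀ S : Set J, LinearIndepOn k v S ↔ LinearIndepOn k w S) {T : Set J} {j : J}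
    (hj : v j ∈ Submodule.span k (v '' T)) : w j ∈ Submodule.span k (w '' T) := by
  obtain ⟨b, hbT, -, hspan, hb⟩ := exists_linearIndepOn_extension (linearIndepOn_empty k v)
    (Set.empty_subset T)
  have hjb : v j ∈ Submodule.span k (v '' b) := Submodule.span_le.2 hspan hj
  rw [hb.mem_span_iff, h] at hjb
  exact Submodule.span_mono (Set.image_mono hbT) (((h b).1 hb).mem_span_iff.2 hjb)

theorem mem_span_image_comp_iff {J ι : Type*} {E E' : Type*} [AddCommGroup E] [Module k E]
    [AddCommGroup E'] [Module k E'] {v : J → E} {w : J → E'}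
    (h : ∀ S : Set J, LinearIndepOn k v S ↔ LinearIndepOn k w S) (c : ι → J) (T : Set ι) (i : ι) :
    v (c i) ∈ Submodule.span k ((fun x => v (c x)) '' T) ↔
      w (c i) ∈ Submodule.span k ((fun x => w (c x)) '' T) := by
  have h1 : (fun x => v (c x)) '' T = v '' (c '' T) := (Set.image_image v c T).symm
  have h2 : (fun x => w (c x)) '' T = w '' (c '' T) := (Set.image_image w c T).symm
  rw [h1, h2]
  exact ⟨mem_span_image_of_linearIndepOn h, mem_span_image_of_linearIndepOn fun S => (h S).symm⟩

theorem prod_mem_prod {ι : Type*} {L : ι → Submodule k R} {f : ι → R} (S : Finset ι)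
    (hf : ∀ i ∈ S, f i ∈ L i) : ∏ i ∈ S, f i ∈ ∏ i ∈ S, L i := by
  classical
  induction S using Finset.induction_on with
  | empty => rw [Finset.prod_empty, Finset.prod_empty]; exact Submodule.one_le.1 le_rfl
  | insert i S hi ih =>
    rw [Finset.prod_insert hi, Finset.prod_insert hi]
    exact Submodule.mul_mem_mul (hf i (by simp)) (ih fun j hj => hf j (by simp [hj]))

theorem finrank_map_eq_of_ker {E E₁ E₂ : Type*} [AddCommGroup E] [Module k E] [AddCommGroup E₁]
    [Module k E₁] [AddCommGroup E₂] [Module k E₂] (f : E →ₗ[k] E₁) (g : E →ₗ[k] E₂)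
    {A : Submodule k E} (h : ∀ x ∈ A, f x = 0 ↔ g x = 0) :
    Module.finrank k (A.map f) = Module.finrank k (A.map g) := by
  have hker : LinearMap.ker (f.domRestrict A) = LinearMap.ker (g.domRestrict A) := by
    ext x
    exact h x x.2
  rw [← LinearMap.range_domRestrict, ← LinearMap.range_domRestrict,
    ← (f.domRestrict A).quotKerEquivRange.finrank_eq,
    ← (g.domRestrict A).quotKerEquivRange.finrank_eq, hker]

section Orbit

variable {r n : ℕ}

/-- Substitution of the product of the generic square matrix with `v`. -/
def orbitHom (v : Matrix (Fin r) (Fin n) k) :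
    MvPolynomial (Fin r × Fin n) k →ₐ[k] MvPolynomial (Fin r × Fin r) k :=
  aeval fun p => linForm p.1 (v.col p.2)

theorem orbitHom_monomial (v : Matrix (Fin r) (Fin n) k) (α : Fin r × Fin n →₀ ℕ) :
    orbitHom v (monomial α 1) = ∏ j, ∏ i, linForm i (v.col j) ^ α (i, j) := by
  rw [orbitHom, aeval_monomial, map_one, one_mul, Finsupp.prod_fintype _ _ fun _ => pow_zero _,
    Fintype.prod_prod_type_right]

theorem eval_orbitHom (v : Matrix (Fin r) (Fin n) k) (g : Matrix (Fin r) (Fin r) k)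
    (p : MvPolynomial (Fin r × Fin n) k) :
    eval (fun q => g q.1 q.2) (orbitHom v p) = eval (fun q => (g * v) q.1 q.2) p := by
  rw [orbitHom, aeval_def, ← coe_eval₂Hom, ← RingHom.comp_apply]
  rw [← eval₂_id, ← coe_eval₂Hom]
  congr 1
  ext1
  · ext1 c; simp
  · simp [linForm_apply, Matrix.mul_apply, mul_comm, smul_eval]

theorem eval_mul_of_mem_gradedPiece {a : Fin r → ℕ} {b : Fin n → ℕ}
    {p : MvPolynomial (Fin r × Fin n) k} (hp : p ∈ gradedPiece k r n a b)
    (x : Matrix (Fin r) (Fin n) k) (s : Fin n → k) :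
    eval (fun q => x q.1 q.2 * s q.2) p = (∏ j, s j ^ b j) * eval (fun q => x q.1 q.2) p := by
  induction hp using Submodule.span_induction with
  | mem p hp =>
    obtain ⟨α, -, hb, rfl⟩ := hp
    rw [eval_monomial, eval_monomial, one_mul, one_mul,
      Finsupp.prod_fintype _ _ fun _ => pow_zero _, Finsupp.prod_fintype _ _ fun _ => pow_zero _]
    simp only [mul_pow, Finset.prod_mul_distrib]
    rw [mul_comm]
    congr 1
    rw [Fintype.prod_prod_type_right]
    refine Finset.prod_congr rfl fun j _ => ?_
    simp only [Finset.prod_pow_eq_pow_sum, hb]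
  | zero => simp
  | add p q _ _ h1 h2 => rw [map_add, map_add, h1, h2, mul_add]
  | smul c p _ h => rw [smul_eval, smul_eval, h, mul_left_comm]

theorem mem_vanIdeal_iff [Infinite k] (v : Matrix (Fin r) (Fin n) k) {a : Fin r → ℕ}
    {b : Fin n → ℕ} {p : MvPolynomial (Fin r × Fin n) k} (hp : p ∈ gradedPiece k r n a b) :
    p ∈ vanIdeal k (matOrbit k v) ↔ orbitHom v p = 0 := by
  constructor
  · intro h
    suffices h0 : orbitHom v p * (Matrix.mvPolynomialX (Fin r) (Fin r) k).det = 0 from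
      (mul_eq_zero.1 h0).resolve_right (Matrix.det_mvPolynomialX_ne_zero _ _)
    refine MvPolynomial.funext fun x => ?_
    rw [map_mul, map_zero, Matrix.eval_det_mvPolynomialX]
    by_cases hx : (Matrix.of fun i j => x (i, j)).det = 0
    · rw [hx, mul_zero]
    · have hu := (Matrix.isUnit_iff_isUnit_det _).2 (isUnit_iff_ne_zero.2 hx)
      have := h (Matrix.of fun i j => (hu.unit.1 * v) i j * ((1 : kˣ)⁻¹ : kˣ)) ⟨hu.unit, 1, rfl⟩
      have h1 := eval_orbitHom v (Matrix.of fun i j => x (i, j)) p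
      simp only [inv_one, Units.val_one, mul_one, Matrix.of_apply, IsUnit.unit_spec] at this h1
      rw [this] at h1
      rw [h1, zero_mul]
  · rintro h _ ⟨g, t, rfl⟩
    have h1 := eval_mul_of_mem_gradedPiece hp (g.1 * v) fun j => ((t j)⁻¹ : kˣ)
    rw [← eval_orbitHom, h, map_zero, mul_zero] at h1
    exact h1

theorem isWeightedHomogeneous_orbitHom_monomial (v : Matrix (Fin r) (Fin n) k)
    (α : Fin r × Fin n →₀ ℕ) :
    IsWeightedHomogeneous (rowWeight r) (orbitHom v (monomial α 1)) fun i => ∑ j, α (i, j) := by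
  rw [orbitHom_monomial]
  have h := IsWeightedHomogeneous.prod (w := rowWeight r) Finset.univ _ _ fun j _ =>
    IsWeightedHomogeneous.prod (w := rowWeight r) Finset.univ _ _ fun i _ =>
      (isWeightedHomogeneous_linForm i (v.col j)).pow (α (i, j))
  convert h using 1
  ext i
  simp [Finset.sum_apply, Pi.single_apply]

theorem prod_formSpace_le {ι : Type*} (v : Matrix (Fin r) (Fin n) k) (c : ι → Fin n)
    (S : Finset ι) :
    ∏ x ∈ S, formSpace (v.col (c x)) ≤ Submodule.span k {f | ∃ α : Fin r × Fin n →₀ ℕ,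
      (∀ j, ∑ i, α (i, j) = (∑ x ∈ S, Pi.single (c x) 1 : Fin n → ℕ) j) ∧
        f = orbitHom v (monomial α 1)} := by
  classical
  induction S using Finset.induction_on with
  | empty =>
    rw [Finset.prod_empty, Submodule.one_le]
    exact Submodule.subset_span ⟨0, by simp, by simp⟩
  | insert x S hx ih =>
    rw [Finset.prod_insert hx, Finset.sum_insert hx, Submodule.mul_le]
    intro f hf g hg
    replace hg := ih hg
    induction hg using Submodule.span_induction with
    | zero => simp
    | add p q _ _ h1 h2 => rw [mul_add]; exact Submodule.add_mem _ h1 h2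
    | smul d p _ h => rw [mul_smul_comm]; exact Submodule.smul_mem _ _ h
    | mem g hg =>
      obtain ⟨α, hα, rfl⟩ := hg
      suffices formSpace (v.col (c x)) ≤ (Submodule.span k _).comap
        (LinearMap.mulRight k (orbitHom v (monomial α 1))) from this hf
      refine iSup_le fun l => (Submodule.span_singleton_le_iff_mem _ _).2
        (Submodule.subset_span ⟨Finsupp.single (l, c x) 1 + α, fun j => ?_, ?_⟩)
      · simp only [Finsupp.add_apply, Finset.sum_add_distrib, hα, Pi.add_apply]
        congr 1
        by_cases h : c x = j
        · subst h
          simp [Finsupp.single_apply]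
        · simp [Ne.symm h]
      · rw [monomial_single_add, pow_one, map_mul, LinearMap.mulRight_apply]
        congr 1
        simp [orbitHom]

theorem map_gradedPiece (v : Matrix (Fin r) (Fin n) k) (a : Fin r → ℕ) (b : Fin n → ℕ) :
    (gradedPiece k r n a b).map (orbitHom v).toLinearMap =
      (∏ x : Σ j, Fin (b j), formSpace (v.col x.1)) ⊓
        weightedHomogeneousSubmodule k (rowWeight r) a := by
  refine le_antisymm ?_ ?_
  · rw [gradedPiece, Submodule.map_span, Submodule.span_le]
    rintro _ ⟨_, ⟨α, ha, hb, rfl⟩, rfl⟩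
    refine ⟨?_, ?_⟩
    · rw [AlgHom.toLinearMap_apply, orbitHom_monomial, Fintype.prod_sigma]
      refine prod_mem_prod _ fun j _ => ?_
      change _ ∈ ∏ _ : Fin (b j), formSpace (v.col j)
      rw [Finset.prod_const, Finset.card_univ, Fintype.card_fin, ← hb j,
        ← Finset.prod_pow_eq_pow_sum]
      exact prod_mem_prod _ fun i _ => Submodule.pow_mem_pow _
        (Submodule.mem_iSup_of_mem i (Submodule.mem_span_singleton_self _)) _
    · have := isWeightedHomogeneous_orbitHom_monomial v α
      rwa [funext ha] at this
  · rintro f ⟨hf, hfa⟩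
    rw [← IsWeightedHomogeneous.weightedHomogeneousComponent_same
      ((mem_weightedHomogeneousSubmodule k _ a _).1 hfa)]
    replace hf := prod_formSpace_le v _ _ hf
    clear hfa
    induction hf using Submodule.span_induction with
    | zero => simp
    | add p q _ _ h1 h2 => rw [map_add]; exact Submodule.add_mem _ h1 h2
    | smul d p _ h => rw [map_smul]; exact Submodule.smul_mem _ _ h
    | mem f hf =>
      obtain ⟨α, hα, rfl⟩ := hf
      have h := isWeightedHomogeneous_orbitHom_monomial v α
      by_cases ha : a = fun i => ∑ j, α (i, j)
      · rw [ha, h.weightedHomogeneousComponent_same]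
        refine Submodule.mem_map_of_mem (Submodule.subset_span ⟨α, fun _ => rfl, fun j => ?_, rfl⟩)
        rw [hα, Fintype.sum_sigma]
        simp [Finset.sum_apply, Pi.single_apply]
      · rw [h.weightedHomogeneousComponent_ne _ ha]
        exact Submodule.zero_mem _

theorem hilbFn_eq_gradedDim [Infinite k] (v : Matrix (Fin r) (Fin n) k) (a : Fin r → ℕ)
    (b : Fin n → ℕ) :
    hilbFn k v a b =
      gradedDim (rowWeight r) (∏ x : Σ j, Fin (b j), formSpace (v.col x.1)) a := by
  rw [gradedDim, ← map_gradedPiece, hilbFn]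
  refine finrank_map_eq_of_ker _ _ fun p hp => ?_
  rw [Submodule.mkQ_apply, Submodule.Quotient.mk_eq_zero, Submodule.restrictScalars_mem,
    mem_vanIdeal_iff v hp, AlgHom.toLinearMap_apply]

end Orbit

theorem linearIndepOn_iff_of_finset {J E E' : Type*} [Finite J] [AddCommGroup E] [Module k E]
    [AddCommGroup E'] [Module k E'] {v : J → E} {w : J → E'}
    (h : ∀ S : Finset J, LinearIndependent k (fun j : S => v j) ↔
      LinearIndependent k (fun j : S => w j)) (S : Set J) :
    LinearIndepOn k v S ↔ LinearIndepOn k w S := by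
  obtain ⟨S, rfl⟩ := S.toFinite.exists_finset_coe
  exact h S

end LinearProduct

/-- If `v` and `w` have equal matroids, then the orbit closures `X_v` and `X_w`
have the same multigraded Hilbert function. -/
theorem hilbert_function_matroid_invariant
    {k : Type*} [Field k] [IsAlgClosed k] [CharZero k] {r n : ℕ}
    (v w : Matrix (Fin r) (Fin n) k)
    (hM : ∀ S : Finset (Fin n),
      LinearIndependent k (fun j : S => fun i => v i (j : Fin n)) ↔
      LinearIndependent k (fun j : S => fun i => w i (j : Fin n)))
    (a : Fin r → ℕ) (b : Fin n → ℕ) :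
    hilbFn k v a b = hilbFn k w a b := by
  have h : ∀ S : Set (Fin n), LinearIndepOn k v.col S ↔ LinearIndepOn k w.col S :=
    LinearProduct.linearIndepOn_iff_of_finset hM
  rw [LinearProduct.hilbFn_eq_gradedDim, LinearProduct.hilbFn_eq_gradedDim]
  refine LinearProduct.gradedDim_prod_eq (v := fun x : Σ j, Fin (b j) => v.col x.1)
    (w := fun x => w.col x.1) ?_ a
  intro T j
  exact LinearProduct.mem_span_image_comp_iff h
    (Sigma.fst : (Σ j, Fin (b j)) → Fin n) (T : Set (Σ j, Fin (b j))) j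
end
end

section
/- Suppose v ∈ k^{r×n} has rank r (its columns span k^r), and let c be the number of equivalence classes of the equivalence relation on {1,…,n} generated by declaring i ∼ j whenever i and j lie in a common circuit of M(v). Then the Krull dimension of the coordinate ring k[x_{ij}]/I(O(v)) of the orbit closure X_v equals r² + n − c. -/
open MvPolynomial

noncomputable section

/-- `S` indexes a linearly independent set of columns of `v`. -/
def ColsIndep (k : Type*) [Field k] {r n : ℕ} (v : Matrix (Fin r) (Fin n) k)
    (S : Finset (Fin n)) : Prop :=
  LinearIndependent k (fun j : S => fun i => v i (j : Fin n))

/-- `C` is a circuit of the matroid of `v`: a minimal dependent set. -/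
def IsCircuitOf (k : Type*) [Field k] {r n : ℕ} (v : Matrix (Fin r) (Fin n) k)
    (C : Finset (Fin n)) : Prop :=
  ¬ ColsIndep k v C ∧ ∀ D : Finset (Fin n), D ⊂ C → ColsIndep k v D

/-- The relation "`i` and `j` lie in a common circuit of `M(v)`". -/
def circuitRel (k : Type*) [Field k] {r n : ℕ} (v : Matrix (Fin r) (Fin n) k)
    (i j : Fin n) : Prop :=
  ∃ C : Finset (Fin n), IsCircuitOf k v C ∧ i ∈ C ∧ j ∈ C

theorem ringKrullDim_eq_of_isIntegral (R S : Type*) [CommRing R] [CommRing S] [Algebra R S]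
    [Algebra.IsIntegral R S] [FaithfulSMul R S] : ringKrullDim S = ringKrullDim R := by
  apply le_antisymm
  · exact Order.krullDim_le_of_strictMono (PrimeSpectrum.comap (algebraMap R S))
      fun I J h => Ideal.IsIntegral.comap_lt_comap h
  · refine iSup_le fun l => ?_
    obtain ⟨P, hP, hlo⟩ :=
      (inferInstance : Nonempty ((RelSeries.head l).asIdeal.primesOver S))
    obtain ⟨L, hL, -⟩ := Ideal.exists_ltSeries_of_hasGoingUp l P
    rw [← hL]
    exact le_iSup (fun p : LTSeries (PrimeSpectrum S) => (p.length : WithBot ℕ∞)) L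

/-- The Krull dimension of a finitely generated domain over a field is its transcendence degree. -/
theorem ringKrullDim_eq_of_trdeg_eq {k A : Type*} [Field k] [CommRing A] [IsDomain A]
    [Algebra k A] [Algebra.FiniteType k A] {d : ℕ} (hd : Algebra.trdeg k A = d) :
    ringKrullDim A = d := by
  obtain ⟨s, g, hg, hint⟩ := exists_integral_inj_algHom_of_fg k A
  let := g.toRingHom.toAlgebra
  have : IsScalarTower k (MvPolynomial (Fin s) k) A :=
    IsScalarTower.of_algebraMap_eq fun x => (g.commutes x).symm
  have : Algebra.IsIntegral (MvPolynomial (Fin s) k) A := ⟨hint⟩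
  have : FaithfulSMul (MvPolynomial (Fin s) k) A :=
    (faithfulSMul_iff_algebraMap_injective _ _).2 hg
  have h := lift_trdeg_add_eq k (MvPolynomial (Fin s) k) A
  rw [trdeg_eq_zero (R := MvPolynomial (Fin s) k), hd] at h
  have hs : s = d := by simpa using h
  rw [ringKrullDim_eq_of_isIntegral (MvPolynomial (Fin s) k) A,
    MvPolynomial.ringKrullDim_of_isNoetherianRing, ringKrullDim_eq_zero_of_field, hs]
  simp

theorem ringKrullDim_quotient_ker_eq_card {k σ τ : Type*} [Field k] [Finite σ] [Finite τ]
    (f : MvPolynomial σ k →ₐ[k] MvPolynomial τ k)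
    [Algebra.IsAlgebraic f.range (MvPolynomial τ k)] :
    ringKrullDim (MvPolynomial σ k ⧸ RingHom.ker f) = Nat.card τ := by
  rw [ringKrullDim_eq_of_ringEquiv (Ideal.quotientKerEquivRange f).toRingEquiv]
  have : Algebra.FiniteType k f.range := .of_surjective f.rangeRestrict f.rangeRestrict_surjective
  apply ringKrullDim_eq_of_trdeg_eq (k := k)
  have h := _root_.trdeg_add_eq k f.range (A := MvPolynomial τ k)
  rw [trdeg_eq_zero (R := f.range), add_zero, MvPolynomial.trdeg_of_isDomain] at h
  rw [h, ← Nat.cast_card]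
  simp

/-- If `P` lies in the field generated by a subalgebra `A`, then `P` is algebraic over `A`. -/
theorem Subalgebra.isAlgebraic_of_mem_intermediateField_adjoin {k P K : Type*} [Field k]
    [CommRing P] [IsDomain P] [Algebra k P] [Field K] [Algebra k K] [Algebra P K]
    [IsScalarTower k P K] [FaithfulSMul P K] (A : Subalgebra k P)
    (h : ∀ x : P, algebraMap P K x ∈ IntermediateField.adjoin k (algebraMap P K '' A)) :
    Algebra.IsAlgebraic A P := by
  refine ⟨fun x => ?_⟩
  have hA : ∀ y ∈ Algebra.adjoin k (algebraMap P K '' (A : Set P)),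
      ∃ a : A, algebraMap P K a = y := by
    intro y hy
    have : Algebra.adjoin k (algebraMap P K '' (A : Set P)) ≤
        A.map (IsScalarTower.toAlgHom k P K) := Algebra.adjoin_le fun _ h => h
    obtain ⟨a, ha, rfl⟩ := this hy
    exact ⟨⟨a, ha⟩, rfl⟩
  obtain ⟨r, hr, s, hs, hx⟩ := IntermediateField.mem_adjoin_iff_div.1 (h x)
  obtain ⟨a, rfl⟩ := hA r hr
  obtain ⟨b, rfl⟩ := hA s hs
  have inj := FaithfulSMul.algebraMap_injective P K
  by_cases hb : b = 0
  · have : x = 0 := inj (by rw [hx, hb]; simp)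
    exact this ▸ isAlgebraic_zero
  · have hb' : algebraMap P K b ≠ 0 := by
      rw [Ne, map_eq_zero_iff _ inj]; simpa using hb
    have hxb : (b : P) * x = a := inj (by rw [map_mul, hx]; field_simp)
    refine ⟨Polynomial.C b * Polynomial.X - Polynomial.C a, fun h0 => hb ?_, ?_⟩
    · simpa using congrArg (Polynomial.coeff · 1) h0
    · simp [hxb]

theorem Matrix.exists_mul_eq_one_of_mulVec_injective {m n k : Type*} [Fintype m] [Fintype n]
    [DecidableEq m] [DecidableEq n] [Field k] (A : Matrix m n k)
    (h : Function.Injective A.mulVec) : ∃ L : Matrix n m k, L * A = 1 := by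
  obtain ⟨g, hg⟩ := LinearMap.exists_leftInverse_of_injective A.mulVecLin
    (LinearMap.ker_eq_bot.2 h)
  refine ⟨LinearMap.toMatrix' g, ?_⟩
  apply Matrix.toLin'.injective
  rw [Matrix.toLin'_mul, Matrix.toLin'_toMatrix', Matrix.toLin'_one]
  exact hg

theorem Matrix.exists_mul_eq_one_of_rank_eq {r : ℕ} {n k : Type*} [Fintype n]
    [DecidableEq n] [Field k] (v : Matrix (Fin r) n k) (hv : v.rank = r) :
    ∃ w : Matrix n (Fin r) k, v * w = 1 := by
  apply Matrix.mulVec_surjective_iff_exists_right_inverse.1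
  have : LinearMap.range v.mulVecLin = ⊤ := by
    apply Submodule.eq_top_of_finrank_eq
    rw [Module.finrank_fin_fun]
    exact hv
  exact LinearMap.range_eq_top.1 this

/-- There is no nontrivial linear relation among the columns of `v` supported on `S`. -/
def Matrix.RelationFree {m n k : Type*} [Fintype n] [Field k] (v : Matrix m n k)
    (S : Finset n) : Prop :=
  ∀ y : n → k, (∀ j ∉ S, y j = 0) → v.mulVec y = 0 → y = 0

section Relations

variable {m n k : Type*} [Fintype n] [Field k]

theorem Matrix.mulVec_eq_submatrix_mulVec (v : Matrix m n k) {S : Finset n} {y : n → k}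
    (hy : ∀ j ∉ S, y j = 0) :
    v.mulVec y = (v.submatrix id (Subtype.val : S → n)).mulVec (fun j => y j) := by
  ext i
  simp only [Matrix.mulVec, dotProduct, Matrix.submatrix_apply, id]
  rw [Finset.sum_coe_sort S (fun j => v i j * y j)]
  exact (Finset.sum_subset (Finset.subset_univ S) fun j _ hj => by simp [hy j hj]).symm

theorem Matrix.relationFree_iff_mulVec_injective (v : Matrix m n k) (S : Finset n) :
    v.RelationFree S ↔
      Function.Injective (v.submatrix id (Subtype.val : S → n)).mulVec := by
  rw [← Matrix.coe_mulVecLin, injective_iff_map_eq_zero]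
  simp only [Matrix.mulVecLin_apply]
  classical
  constructor
  · intro h z hz
    have hy : ∀ j ∉ S, (fun j => if h : j ∈ S then z ⟨j, h⟩ else 0) j = 0 :=
      fun j hj => by simp [hj]
    have := h _ hy (by rw [v.mulVec_eq_submatrix_mulVec hy]; simpa using hz)
    ext j
    simpa using congrFun this j
  · intro h y hy hvy
    rw [v.mulVec_eq_submatrix_mulVec hy] at hvy
    have := h _ hvy
    ext j
    by_cases hj : j ∈ S
    · exact congrFun this ⟨j, hj⟩
    · exact hy j hj

theorem Matrix.RelationFree.map_algebraMap [Fintype m] {v : Matrix m n k}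
    {S : Finset n} (h : v.RelationFree S) (K : Type*) [Field K] [Algebra k K] :
    (v.map (algebraMap k K)).RelationFree S := by
  rw [Matrix.relationFree_iff_mulVec_injective] at h ⊢
  classical
  obtain ⟨L, hL⟩ := Matrix.exists_mul_eq_one_of_mulVec_injective _ h
  have hL' : L.map (algebraMap k K) *
      (v.map (algebraMap k K)).submatrix id (Subtype.val : S → n) = 1 := by
    rw [Matrix.submatrix_map, ← Matrix.map_mul, hL]
    simp
  apply Function.LeftInverse.injective (g := (L.map (algebraMap k K)).mulVec)
  intro y
  rw [Matrix.mulVec_mulVec, hL', Matrix.one_mulVec]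

/-- A minimal set of columns of `v` carrying a nontrivial linear relation. -/
def Matrix.IsMinimalRelated (v : Matrix m n k) (C : Finset n) : Prop :=
  ¬ v.RelationFree C ∧ ∀ D : Finset n, D ⊂ C → v.RelationFree D

theorem Matrix.RelationFree.exists_of_not {v : Matrix m n k} {S : Finset n}
    (h : ¬ v.RelationFree S) :
    ∃ y : n → k, (∀ j ∉ S, y j = 0) ∧ v.mulVec y = 0 ∧ y ≠ 0 := by
  simpa [Matrix.RelationFree] using h

theorem Matrix.exists_isMinimalRelated_subset {v : Matrix m n k} {S : Finset n}
    (h : ¬ v.RelationFree S) : ∃ C ⊆ S, v.IsMinimalRelated C := by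
  induction S using Finset.strongInduction with
  | H S ih =>
    by_cases hS : ∀ D ⊂ S, v.RelationFree D
    · exact ⟨S, subset_rfl, h, hS⟩
    · push Not at hS
      obtain ⟨D, hDS, hD⟩ := hS
      obtain ⟨C, hCD, hC⟩ := ih D hDS hD
      exact ⟨C, hCD.trans hDS.subset, hC⟩

theorem Matrix.apply_ne_zero_of_relation [DecidableEq n] {v : Matrix m n k} {C : Finset n}
    {y : n → k} (hy : ∀ j ∉ C, y j = 0) (hvy : v.mulVec y = 0) (hy0 : y ≠ 0) {i : n}
    (h : v.RelationFree (C.erase i)) : y i ≠ 0 := fun hi => hy0 <| h y (fun j hj => by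
  by_cases hji : j = i
  · rw [hji, hi]
  · exact hy j fun hjC => hj (Finset.mem_erase.2 ⟨hji, hjC⟩)) hvy

theorem Matrix.relation_proportional [DecidableEq n] {v : Matrix m n k} {C : Finset n}
    {y z : n → k} (hy : ∀ j ∉ C, y j = 0) (hvy : v.mulVec y = 0)
    (hz : ∀ j ∉ C, z j = 0) (hvz : v.mulVec z = 0) {i : n}
    (h : v.RelationFree (C.erase i)) (j : n) : y i * z j = z i * y j := by
  have := h (y i • z - z i • y) (fun j hj => by
    by_cases hji : j = i
    · subst hji; simp [mul_comm]
    · have hjC : j ∉ C := fun hjC => hj (Finset.mem_erase.2 ⟨hji, hjC⟩)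
      simp [hy j hjC, hz j hjC]) (by
    rw [Matrix.mulVec_sub, Matrix.mulVec_smul, Matrix.mulVec_smul, hvy, hvz]; simp)
  simpa [sub_eq_zero] using congrFun this j

/-- Rescaling a linear relation by a function constant on circuits yields a linear relation. -/
theorem Matrix.mulVec_mul_eq_zero_of_constant_on_circuits {v : Matrix m n k} {s : n → k}
    (hs : ∀ C, v.IsMinimalRelated C → ∀ i ∈ C, ∀ j ∈ C, s i = s j) (y : n → k)
    (hy : v.mulVec y = 0) : v.mulVec (s * y) = 0 := by
  classical
  generalize hS : Finset.univ.filter (fun j => y j ≠ 0) = S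
  induction S using Finset.strongInduction generalizing y with
  | H S ih =>
    have hyS : ∀ j, j ∈ S ↔ y j ≠ 0 := fun j => by simp [← hS]
    by_cases hy0 : y = 0
    · simp [hy0]
    have hdep : ¬ v.RelationFree S := fun h =>
      hy0 (h y (fun j hj => by simpa [hyS] using hj) hy)
    obtain ⟨C, hCS, hC⟩ := Matrix.exists_isMinimalRelated_subset hdep
    obtain ⟨z, hzC, hvz, hz0⟩ := Matrix.RelationFree.exists_of_not hC.1
    obtain ⟨i, hi⟩ := Function.ne_iff.1 hz0
    have hiC : i ∈ C := by
      by_contra h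
      exact hi (hzC i h)
    have hsz : s * z = s i • z := by
      ext j
      by_cases hj : j ∈ C
      · simp [hs C hC i hiC j hj]
      · simp [hzC j hj]
    have hvy' : v.mulVec (y - (y i / z i) • z) = 0 := by
      rw [Matrix.mulVec_sub, Matrix.mulVec_smul, hy, hvz]; simp
    have hi' : z i ≠ 0 := hi
    have key := ih (Finset.univ.filter fun j => (y - (y i / z i) • z) j ≠ 0) (by
      refine Finset.ssubset_iff_subset_ne.2 ⟨fun j hj => ?_, fun h => ?_⟩
      · by_contra hjS
        have hyj : y j = 0 := by simpa [hyS] using hjS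
        have hzj : z j = 0 := hzC j fun h => hjS (hCS h)
        simp [hyj, hzj] at hj
      · have hiS := hCS hiC
        rw [← h] at hiS
        simp [hi'] at hiS) _ hvy' rfl
    have hdecomp : s * y = s * (y - (y i / z i) • z) + (y i / z i) • (s * z) := by
      ext j
      simp
      ring
    rw [hdecomp, Matrix.mulVec_add, key, hsz, Matrix.mulVec_smul, Matrix.mulVec_smul, hvz]
    simp

theorem Matrix.exists_mul_eq_mul_diagonal [Fintype m] [DecidableEq m] [DecidableEq n]
    {v : Matrix m n k} {w : Matrix n m k} (hw : v * w = 1) {s : n → k}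
    (hs : ∀ C, v.IsMinimalRelated C → ∀ i ∈ C, ∀ j ∈ C, s i = s j) :
    ∃ h : Matrix m m k, h * v = v * Matrix.diagonal s := by
  refine ⟨v * Matrix.diagonal s * w, ?_⟩
  have h0 : v * (w * v - 1) = 0 := by
    rw [Matrix.mul_sub, ← Matrix.mul_assoc, hw]; simp
  have h1 : v * (Matrix.diagonal s * (w * v - 1)) = 0 := by
    ext i j
    have := congrFun (Matrix.mulVec_mul_eq_zero_of_constant_on_circuits hs
      (fun a => (w * v - 1 : Matrix n n k) a j) (funext fun i => congrFun (congrFun h0 i) j)) i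
    rw [Matrix.mul_apply]
    simp only [Matrix.diagonal_mul]
    exact this
  rw [Matrix.mul_sub, Matrix.mul_sub, sub_eq_zero] at h1
  simpa [Matrix.mul_assoc] using h1

/-- Column scalings recovered from the entries of `g v diag(u)`: the ratio of the scalings at two
elements of a common circuit lies in the field generated by the entries. -/
theorem Matrix.IsMinimalRelated.div_mem [Fintype m] [DecidableEq m] [DecidableEq n]
    {K : Type*} [Field K] [Algebra k K] {v : Matrix m n k} {C : Finset n}
    (hC : v.IsMinimalRelated C) (F : IntermediateField k K) {g h : Matrix m m K}
    (hg : h * g = 1) {u : n → K} (hu : ∀ j, u j ≠ 0) {W : Matrix m n F}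
    (hW : W.map (algebraMap F K) = g * v.map (algebraMap k K) * Matrix.diagonal u)
    {i j : n} (hi : i ∈ C) (hj : j ∈ C) : u j / u i ∈ F := by
  have hWu (z : n → K) : (W.map (algebraMap F K)).mulVec z =
      g.mulVec ((v.map (algebraMap k K)).mulVec (u * z)) := by
    rw [hW, ← Matrix.mulVec_mulVec, ← Matrix.mulVec_mulVec]
    congr 2
    ext a
    simp [Matrix.mulVec_diagonal]
  obtain ⟨y, hyC, hvy, hy0⟩ := Matrix.RelationFree.exists_of_not hC.1
  have hvy' : (v.map (algebraMap k K)).mulVec (algebraMap k K ∘ y) = 0 := by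
    ext a
    have := RingHom.map_mulVec (algebraMap k K) v y a
    rw [hvy] at this
    simpa using this.symm
  have hdep : ¬ W.RelationFree C := fun hfree => by
    have := hfree.map_algebraMap K (fun a => algebraMap k K (y a) / u a)
      (fun a ha => by simp [hyC a ha]) (by
        rw [hWu]
        have : (u * fun a => algebraMap k K (y a) / u a) = algebraMap k K ∘ y := by
          ext a
          simp [mul_div_cancel₀ _ (hu a)]
        rw [this, hvy', Matrix.mulVec_zero])
    apply hy0
    ext a
    simpa [hu a] using congrFun this a
  obtain ⟨f, hfC, hWf, hf0⟩ := Matrix.RelationFree.exists_of_not hdep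
  set z : n → K := fun a => u a * algebraMap F K (f a) with hz
  have hvz : (v.map (algebraMap k K)).mulVec z = 0 := by
    have h1 : (W.map (algebraMap F K)).mulVec (algebraMap F K ∘ f) = 0 := by
      ext a
      have := RingHom.map_mulVec (algebraMap F K) W f a
      rw [hWf] at this
      simpa using this.symm
    rw [hWu] at h1
    have h2 := congrArg h.mulVec h1
    rwa [Matrix.mulVec_mulVec, hg, Matrix.one_mulVec, Matrix.mulVec_zero] at h2
  have hzC : ∀ a ∉ C, z a = 0 := fun a ha => by simp [hz, hfC a ha]
  have hz0 : z ≠ 0 := fun h0 => hf0 <| by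
    ext a
    simpa [hz, hu a] using congrFun h0 a
  have free (a : n) (ha : a ∈ C) := hC.2 _ (Finset.erase_ssubset ha)
  have hyi := Matrix.apply_ne_zero_of_relation hyC hvy hy0 (free i hi)
  have hzi := Matrix.apply_ne_zero_of_relation hzC hvz hz0 ((free i hi).map_algebraMap K)
  have hzj := Matrix.apply_ne_zero_of_relation hzC hvz hz0 ((free j hj).map_algebraMap K)
  have hprop := Matrix.relation_proportional (y := algebraMap k K ∘ y)
    (fun a ha => by simp [hyC a ha]) hvy' hzC hvz ((free i hi).map_algebraMap K) j
  have hyi' : algebraMap k K (y i) ≠ 0 := by simpa using hyi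
  have hfj : algebraMap F K (f j) ≠ 0 := fun h0 => hzj (by simp only [hz, h0, mul_zero])
  have : u j / u i = algebraMap k K (y j / y i) * algebraMap F K (f i / f j) := by
    rw [map_div₀, map_div₀, div_mul_div_comm, div_eq_div_iff (hu i) (mul_ne_zero hyi' hfj)]
    simp only [hz, Function.comp_apply] at hprop
    linear_combination hprop
  rw [this]
  exact mul_mem (F.algebraMap_mem _) (f i / f j).2

end Relations

section OrbitParametrization

variable {k : Type*} [Field k] {r n : ℕ}

theorem colsIndep_iff_relationFree (v : Matrix (Fin r) (Fin n) k) (S : Finset (Fin n)) :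
    ColsIndep k v S ↔ v.RelationFree S := by
  rw [Matrix.relationFree_iff_mulVec_injective, Matrix.mulVec_injective_iff]
  rfl

theorem isCircuitOf_iff_isMinimalRelated (v : Matrix (Fin r) (Fin n) k) (C : Finset (Fin n)) :
    IsCircuitOf k v C ↔ v.IsMinimalRelated C := by
  simp only [IsCircuitOf, Matrix.IsMinimalRelated, colsIndep_iff_relationFree]

/-- Parameters for the orbit: a square matrix, and a column scaling for every index which is not
fixed by `ρ`. -/
abbrev OrbitParam (r : ℕ) {n : ℕ} (ρ : Fin n → Fin n) : Type :=
  (Fin r × Fin r) ⊕ {i : Fin n // ρ i ≠ i}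

variable (k) in
/-- The generic square matrix. -/
def genericFrame (r : ℕ) {n : ℕ} (ρ : Fin n → Fin n) :
    Matrix (Fin r) (Fin r) (MvPolynomial (OrbitParam r ρ) k) :=
  Matrix.of fun i a => X (Sum.inl (i, a))

variable (k) in
/-- The generic column scaling which is `1` at the fixed points of `ρ`. -/
def genericScaling (r : ℕ) {n : ℕ} (ρ : Fin n → Fin n) (j : Fin n) :
    MvPolynomial (OrbitParam r ρ) k :=
  if h : ρ j = j then 1 else X (Sum.inr ⟨j, h⟩)

/-- The pullback of functions along `(g, u) ↦ g v diag(u)`. -/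
def orbitPullback (v : Matrix (Fin r) (Fin n) k) (ρ : Fin n → Fin n) :
    MvPolynomial (Fin r × Fin n) k →ₐ[k] MvPolynomial (OrbitParam r ρ) k :=
  aeval fun ij => (genericFrame k r ρ * v.map (C : k →+* MvPolynomial (OrbitParam r ρ) k) *
    Matrix.diagonal (genericScaling k r ρ)) ij.1 ij.2

theorem eval_orbitPullback (v : Matrix (Fin r) (Fin n) k) (ρ : Fin n → Fin n)
    (x : OrbitParam r ρ → k) (p : MvPolynomial (Fin r × Fin n) k) :
    eval x (orbitPullback v ρ p) =
      eval (fun ij => ((genericFrame k r ρ).map (eval x) * v *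
        Matrix.diagonal fun j => eval x (genericScaling k r ρ j)) ij.1 ij.2) p := by
  induction p using MvPolynomial.induction_on with
  | C a => simp [orbitPullback]
  | add p q hp hq => simp only [map_add, hp, hq]
  | mul_X p ij hp =>
    rw [map_mul, map_mul, hp, map_mul, eval_X, orbitPullback, aeval_X]
    simp only [Matrix.mul_diagonal, map_mul]
    simp [Matrix.mul_apply]

theorem det_genericFrame_ne_zero (ρ : Fin n → Fin n) : (genericFrame k r ρ).det ≠ 0 := fun h => by
  have := congrArg (eval (Sum.elim (fun ia => (1 : Matrix (Fin r) (Fin r) k) ia.1 ia.2) 0)) h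
  rw [RingHom.map_det] at this
  have h1 : (eval (Sum.elim (fun ia => (1 : Matrix (Fin r) (Fin r) k) ia.1 ia.2)
      (0 : {i : Fin n // ρ i ≠ i} → k))).mapMatrix (genericFrame k r ρ) = 1 := by
    ext i a
    simp [genericFrame]
  rw [h1] at this
  simp at this

theorem genericScaling_ne_zero (ρ : Fin n → Fin n) (j : Fin n) :
    genericScaling k r ρ j ≠ 0 := by
  unfold genericScaling
  split_ifs
  · exact one_ne_zero
  · exact X_ne_zero _

theorem ker_orbitPullback [Infinite k] {v : Matrix (Fin r) (Fin n) k} (hv : v.rank = r)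
    {ρ : Fin n → Fin n} (hρ : ∀ C, v.IsMinimalRelated C → ∀ i ∈ C, ∀ j ∈ C, ρ i = ρ j) :
    RingHom.ker (orbitPullback v ρ) = vanIdeal k (matOrbit k v) := by
  ext p
  rw [RingHom.mem_ker]
  constructor
  · rintro hp w ⟨g, t, rfl⟩
    obtain ⟨v', hv'⟩ := v.exists_mul_eq_one_of_rank_eq hv
    obtain ⟨h, hh⟩ := Matrix.exists_mul_eq_mul_diagonal hv'
      (s := fun j => ((t (ρ j))⁻¹ : kˣ)) fun C hC i hi j hj => by rw [hρ C hC i hi j hj]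
    have := congrArg (eval (Sum.elim (fun ia : Fin r × Fin r => (g.1 * h) ia.1 ia.2)
      (fun j : {i : Fin n // ρ i ≠ i} => (t (ρ j) : k) * ((t j)⁻¹ : kˣ)))) hp
    rw [eval_orbitPullback, map_zero] at this
    rw [← this]
    congr 2
    ext ij
    have h1 : (genericFrame k r ρ).map (eval (Sum.elim
        (fun ia : Fin r × Fin r => (g.1 * h) ia.1 ia.2) (fun j : {i : Fin n // ρ i ≠ i} => (t (ρ j) : k) * ((t j)⁻¹ : kˣ)))) = g.1 * h := by
      ext i a
      simp [genericFrame]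
    rw [h1, Matrix.mul_assoc g.1 h v, hh, ← Matrix.mul_assoc,
      Matrix.mul_assoc _ _ (Matrix.diagonal _), Matrix.diagonal_mul_diagonal, Matrix.mul_diagonal, Matrix.of_apply]
    congr 1
    unfold genericScaling
    split_ifs with hj
    · simp [hj]
    · simp
  · intro hp
    have hprod : orbitPullback v ρ p *
        ((genericFrame k r ρ).det * ∏ j, genericScaling k r ρ j) = 0 := by
      apply MvPolynomial.funext
      intro x
      rw [map_mul, map_zero, map_mul, map_prod, RingHom.map_det]
      by_cases hdet : ((eval x).mapMatrix (genericFrame k r ρ)).det = 0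
      · rw [hdet, zero_mul, mul_zero]
      by_cases hu : ∀ j, eval x (genericScaling k r ρ j) ≠ 0
      · rw [eval_orbitPullback, hp _ ⟨((Matrix.isUnit_iff_isUnit_det _).2
          (isUnit_iff_ne_zero.2 hdet)).unit, fun j => (Units.mk0 _ (hu j))⁻¹, ?_⟩, zero_mul]
        ext i j
        simp [Matrix.mul_diagonal]
      · push Not at hu
        obtain ⟨j, hj⟩ := hu
        rw [Finset.prod_eq_zero (Finset.mem_univ j) hj]
        simp
    exact (mul_eq_zero.1 hprod).resolve_right (mul_ne_zero (det_genericFrame_ne_zero ρ)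
      (Finset.prod_ne_zero_iff.2 fun j _ => genericScaling_ne_zero ρ j))

theorem isAlgebraic_range_orbitPullback {v : Matrix (Fin r) (Fin n) k} (hv : v.rank = r)
    {ρ : Fin n → Fin n} (hρ : ∀ j, Relation.EqvGen (circuitRel k v) (ρ j) j)
    (hρρ : ∀ j, ρ (ρ j) = ρ j) :
    Algebra.IsAlgebraic (orbitPullback v ρ).range (MvPolynomial (OrbitParam r ρ) k) := by
  let P := MvPolynomial (OrbitParam r ρ) k
  let K := FractionRing P
  have inj : Function.Injective (algebraMap P K) := FaithfulSMul.algebraMap_injective P K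
  apply Subalgebra.isAlgebraic_of_mem_intermediateField_adjoin (K := K)
  set F := IntermediateField.adjoin k (algebraMap P K '' (orbitPullback v ρ).range) with hF
  set g : Matrix (Fin r) (Fin r) K := (genericFrame k r ρ).map (algebraMap P K) with hg
  set u : Fin n → K := fun j => algebraMap P K (genericScaling k r ρ j) with hu
  have hu0 (j) : u j ≠ 0 := by
    simpa [hu] using (map_ne_zero_iff _ inj).2 (genericScaling_ne_zero (k := k) (r := r) ρ j)
  have hdet : IsUnit g.det := by
    have : g.det = algebraMap P K (genericFrame k r ρ).det := by
      rw [RingHom.map_det]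
      rfl
    rw [this, isUnit_iff_ne_zero]
    exact (map_ne_zero_iff _ inj).2 (det_genericFrame_ne_zero ρ)
  let W : Matrix (Fin r) (Fin n) F := Matrix.of fun i j =>
    ⟨algebraMap P K (orbitPullback v ρ (X (i, j))),
      IntermediateField.subset_adjoin _ _ ⟨_, ⟨_, rfl⟩, rfl⟩⟩
  have hC (a : k) : algebraMap P K (C a) = algebraMap k K a :=
    (IsScalarTower.algebraMap_apply k P K a).symm
  have hW : W.map (algebraMap F K) = g * v.map (algebraMap k K) * Matrix.diagonal u := by
    ext i j
    change algebraMap P K (orbitPullback v ρ (X (i, j))) = _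
    rw [orbitPullback, aeval_X, Matrix.mul_diagonal, Matrix.mul_diagonal, map_mul,
      Matrix.mul_apply, Matrix.mul_apply, map_sum]
    simp only [map_mul, Matrix.map_apply, hC, hg, hu]
  have hratio {i j : Fin n} (hij : Relation.EqvGen (circuitRel k v) i j) : u j / u i ∈ F := by
    induction hij with
    | rel i j h =>
      obtain ⟨C, hC, hi, hj⟩ := h
      exact ((isCircuitOf_iff_isMinimalRelated v C).1 hC).div_mem F
        (Matrix.nonsing_inv_mul g hdet) hu0 hW hi hj
    | refl i => rw [div_self (hu0 i)]; exact one_mem F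
    | symm i j _ h => rw [← inv_div]; exact inv_mem h
    | trans i j l _ _ h₁ h₂ =>
      rw [← div_mul_div_cancel₀ (hu0 j)]
      exact mul_mem h₂ h₁
  have huF (j) : u j ∈ F := by
    have h1 : u (ρ j) = 1 := by simp [hu, genericScaling, hρρ]
    simpa [h1] using hratio (hρ j)
  have hgvF (i j) : (g * v.map (algebraMap k K)) i j ∈ F := by
    have h1 : (g * v.map (algebraMap k K)) i j = algebraMap F K (W i j) / u j := by
      have := congrFun (congrFun hW i) j
      rw [Matrix.mul_diagonal, Matrix.map_apply] at this
      rw [this, mul_div_cancel_right₀ _ (hu0 j)]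
    rw [h1]
    exact div_mem (W i j).2 (huF j)
  have hgF (i a) : g i a ∈ F := by
    obtain ⟨v', hv'⟩ := v.exists_mul_eq_one_of_rank_eq hv
    have h1 : g = g * v.map (algebraMap k K) * v'.map (algebraMap k K) := by
      rw [Matrix.mul_assoc, ← Matrix.map_mul, hv']
      simp
    rw [h1, Matrix.mul_apply]
    exact sum_mem fun j _ => mul_mem (hgvF i j) (F.algebraMap_mem _)
  intro x
  induction x using MvPolynomial.induction_on with
  | C a => exact hC a ▸ F.algebraMap_mem a
  | add p q hp hq => rw [map_add]; exact add_mem hp hq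
  | mul_X p z hp =>
    rw [map_mul]
    refine mul_mem hp ?_
    rcases z with ⟨i, a⟩ | ⟨j, hj⟩
    · exact hgF i a
    · simpa [hu, genericScaling, hj] using huF j

theorem card_orbitParam_out (R : Fin n → Fin n → Prop) :
    Nat.card (OrbitParam r fun j => (Quot.mk R j).out) = r ^ 2 + n - Nat.card (Quot R) := by
  classical
  have e : {j : Fin n // (Quot.mk R j).out = j} ≃ Quot R :=
    { toFun := fun j => Quot.mk R j
      invFun := fun q => ⟨q.out, by rw [Quot.out_eq]⟩
      left_inv := fun j => Subtype.ext j.2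
      right_inv := fun q => Quot.out_eq q }
  have h := Fintype.card_subtype_compl fun j : Fin n => (Quot.mk R j).out = j
  have hle := Fintype.card_subtype_le fun j : Fin n => (Quot.mk R j).out = j
  rw [Fintype.card_fin] at h hle
  rw [← Nat.card_congr e, Nat.card_eq_fintype_card, Nat.card_eq_fintype_card, Fintype.card_sum, h]
  simp only [Fintype.card_prod, Fintype.card_fin, sq]
  omega

end OrbitParametrization

/-- If `v` has rank `r` and its matroid has `c` connected components (equivalence
classes of the equivalence relation generated by lying in a common circuit), then
the Krull dimension of the coordinate ring of the orbit closure `X_v` is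
`r² + n − c`. -/
theorem krull_dimension_orbit_closure
    {k : Type*} [Field k] [IsAlgClosed k] [CharZero k] {r n : ℕ}
    (v : Matrix (Fin r) (Fin n) k) (hv : v.rank = r) :
    ringKrullDim (MvPolynomial (Fin r × Fin n) k ⧸ vanIdeal k (matOrbit k v)) =
      ((r ^ 2 + n - Nat.card (Quot (circuitRel k v)) : ℕ) : WithBot (WithTop ℕ)) := by
  let ρ : Fin n → Fin n := fun j => (Quot.mk (circuitRel k v) j).out
  have hρ (j) : Quot.mk (circuitRel k v) (ρ j) = Quot.mk _ j := Quot.out_eq _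
  have := isAlgebraic_range_orbitPullback hv (fun j => Quot.eqvGen_exact (hρ j))
    fun j => congrArg Quot.out (hρ j)
  rw [← ker_orbitPullback hv (ρ := ρ) fun C hC i hi j hj => congrArg Quot.out (Quot.sound
    ⟨C, (isCircuitOf_iff_isMinimalRelated v C).2 hC, hi, hj⟩),
    ringKrullDim_quotient_ker_eq_card, card_orbitParam_out]
  rfl
end
end

section
/- Suppose v ∈ k^{r×n} has rank r, and let w ∈ X_v be a matrix of rank strictly less than r. Then there exist a matrix w' ∈ X_v of rank r and a singular matrix g ∈ k^{r×r} (i.e. det g = 0) such that w = g·w'. -/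
open MvPolynomial

noncomputable section

open Matrix in
/-- A matrix of full row rank has a nonvanishing maximal minor. -/
theorem exists_det_submatrix_ne_zero {F : Type*} [Field F] {r n : ℕ}
    (M : Matrix (Fin r) (Fin n) F) (hM : M.rank = r) :
    ∃ c : Fin r → Fin n, (M.submatrix id c).det ≠ 0 := by
  rw [rank_eq_finrank_span_cols] at hM
  have hspan := Submodule.exists_fun_fin_finrank_span_eq F (Set.range M.col)
  rw [hM] at hspan
  obtain ⟨f, hf, -, hli⟩ := hspan
  choose c hc using hf
  refine ⟨c, ?_⟩
  rw [← isUnit_iff_ne_zero, ← Matrix.isUnit_iff_isUnit_det, ← linearIndependent_cols_iff_isUnit]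
  have hcf : (M.submatrix id c).col = f := funext hc
  rwa [hcf]

open Matrix in
/-- Over a valuation ring, a matrix with a nonzero maximal minor has a row-equivalent integral
matrix containing the identity as a maximal submatrix. -/
theorem ValuationSubring.exists_submatrix_inv_mul_mem {K : Type*} [Field K]
    (B : ValuationSubring K) {r n : ℕ} (U : Matrix (Fin r) (Fin n) K)
    (hU : ∃ c : Fin r → Fin n, (U.submatrix id c).det ≠ 0) :
    ∃ c : Fin r → Fin n, (U.submatrix id c).det ≠ 0 ∧
      ∀ i j, ((U.submatrix id c)⁻¹ * U) i j ∈ B := by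
  obtain ⟨c₀, hc₀⟩ := hU
  have : Nonempty (Fin r → Fin n) := ⟨c₀⟩
  obtain ⟨c, hc⟩ := Finite.exists_max
    fun c : Fin r → Fin n => B.valuation (U.submatrix id c).det
  have hdet : (U.submatrix id c).det ≠ 0 := by
    intro h
    have := hc c₀
    rw [h, map_zero, le_zero_iff, map_eq_zero] at this
    exact hc₀ this
  refine ⟨c, hdet, fun i j => ?_⟩
  have hcramer : ((U.submatrix id c)⁻¹ * U) i j =
      (U.submatrix id c).det⁻¹ * (U.submatrix id (Function.update c i j)).det := by
    have hupd : U.submatrix id (Function.update c i j) =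
        (U.submatrix id c).updateCol i (U.col j) := by
      ext a b
      by_cases hb : b = i
      · subst hb; simp
      · simp [hb]
    rw [hupd, ← cramer_apply, cramer_eq_adjugate_mulVec, inv_def, Ring.inverse_eq_inv',
      smul_mul, Matrix.smul_apply, smul_eq_mul]
    rfl
  rw [← B.valuation_le_one_iff, hcramer, map_mul, map_inv₀]
  have hpos : B.valuation (U.submatrix id c).det ≠ 0 := by simpa using hdet
  calc _ ≤ (B.valuation (U.submatrix id c).det)⁻¹ * B.valuation (U.submatrix id c).det := by
        gcongr; exact hc _
    _ = 1 := inv_mul_cancel₀ hpos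

/-- A point over an extension of an algebraically closed field specializes to a rational point. -/
theorem exists_eval_eq_zero_of_eval₂_eq_zero {k L σ : Type*} [Field k] [IsAlgClosed k] [Finite σ]
    [CommRing L] [Nontrivial L] (f : k →+* L) (x : σ → L) :
    ∃ y : σ → k, ∀ p : MvPolynomial σ k, eval₂ f x p = 0 → eval y p = 0 := by
  obtain ⟨M, hM, hle⟩ := Ideal.exists_le_maximal (RingHom.ker (eval₂Hom f x))
    (RingHom.ker_ne_top _)
  obtain ⟨y, rfl⟩ := isMaximal_iff_eq_vanishingIdeal_singleton.1 hM
  refine ⟨y, fun p hp => ?_⟩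
  have := hle (show p ∈ RingHom.ker (eval₂Hom f x) from hp)
  simpa [mem_vanishingIdeal_singleton_iff] using this

/-- A point `x` at which every algebraic relation between elements `U i` of a field `K` holds is
the specialization of `U` along some valuation ring of `K`. -/
theorem exists_valuationSubring_specialization {k K σ : Type*} [Field k] [Field K] [Algebra k K]
    (U : σ → K) (x : σ → k)
    (h : ∀ p : MvPolynomial σ k, aeval U p = 0 → eval x p = 0) :
    ∃ B : ValuationSubring K, (∀ a : k, algebraMap k K a ∈ B) ∧
      (∀ i, U i ∈ B) ∧ ∀ i, U i - algebraMap k K (x i) ∈ B.nonunits := by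
  let φ : MvPolynomial σ k →+* K := (aeval U : MvPolynomial σ k →ₐ[k] K)
  let I : Ideal φ.range := (RingHom.ker (eval x)).map φ.rangeRestrict
  have hI : I ≠ ⊤ := by
    rw [Ne, Ideal.eq_top_iff_one, Ideal.mem_map_iff_of_surjective _ φ.rangeRestrict_surjective]
    rintro ⟨q, hq, hq1⟩
    have hq1 : φ q = 1 := congrArg Subtype.val hq1
    have h1 := h (q - 1) (by
      rw [map_sub, map_one, sub_eq_zero]; exact hq1)
    rw [RingHom.mem_ker] at hq
    simp [hq] at h1
  obtain ⟨B, hB, hIB⟩ := I.image_subset_nonunits_valuationSubring hI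
  refine ⟨B, fun a => hB ⟨C a, by simp [φ]⟩, fun i => hB ⟨X i, by simp [φ]⟩, fun i => ?_⟩
  refine hIB ⟨φ.rangeRestrict (X i - C (x i)), Ideal.mem_map_of_mem _ (by simp), ?_⟩
  simp [φ]

/-- The generic point of the orbit of `v`: the matrix `y v diag(u)` with all entries of `y` and
`u` independent variables. -/
def genericOrbitPoint {k : Type*} [Field k] {r n : ℕ} (v : Matrix (Fin r) (Fin n) k) :
    Fin r × Fin n → MvPolynomial ((Fin r × Fin r) ⊕ Fin n) k :=
  fun ij => (∑ a, X (Sum.inl (ij.1, a)) * C (v a ij.2)) * X (Sum.inr ij.2)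

theorem aeval_genericOrbitPoint {k : Type*} [Field k] {r n : ℕ} (v : Matrix (Fin r) (Fin n) k)
    {R : Type*} [CommRing R] [Algebra k R] (y : Matrix (Fin r) (Fin r) R) (u : Fin n → R)
    (p : MvPolynomial (Fin r × Fin n) k) :
    aeval (Sum.elim (fun ij => y ij.1 ij.2) u) (aeval (genericOrbitPoint v) p) =
      aeval (fun ij => (y * v.map (algebraMap k R)) ij.1 ij.2 * u ij.2) p := by
  rw [← AlgHom.comp_apply, comp_aeval]
  simp [genericOrbitPoint, Matrix.mul_apply]

/-- The matrix of independent variables has nonzero determinant. -/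
theorem det_X_inl_ne_zero (k : Type*) [Field k] (m τ : Type*) [Fintype m] [DecidableEq m] :
    (Matrix.of fun i j => X (Sum.inl (i, j)) : Matrix m m (MvPolynomial ((m × m) ⊕ τ) k)).det
      ≠ 0 := by
  have h := Matrix.det_mvPolynomialX_ne_zero m k
  contrapose! h
  have := congrArg (aeval (Sum.elim X 0) :
    MvPolynomial ((m × m) ⊕ τ) k →ₐ[k] MvPolynomial (m × m) k) h
  rw [map_zero, AlgHom.map_det] at this
  convert this
  ext i j
  simp [Matrix.mvPolynomialX]

theorem mem_vanIdeal_matOrbit_iff {k : Type*} [Field k] [Infinite k] {r n : ℕ}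
    {v : Matrix (Fin r) (Fin n) k} {p : MvPolynomial (Fin r × Fin n) k} :
    p ∈ vanIdeal k (matOrbit k v) ↔ aeval (genericOrbitPoint v) p = 0 := by
  constructor
  · intro hp
    let Y : Matrix (Fin r) (Fin r) (MvPolynomial ((Fin r × Fin r) ⊕ Fin n) k) :=
      Matrix.of fun i j => X (Sum.inl (i, j))
    let T : Fin n → MvPolynomial ((Fin r × Fin r) ⊕ Fin n) k := fun j => X (Sum.inr j)
    have hT : ∏ j, T j ≠ 0 := Finset.prod_ne_zero_iff.2 fun j _ => X_ne_zero _
    have hmul : aeval (genericOrbitPoint v) p * (Y.det * ∏ j, T j) = 0 := by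
      refine MvPolynomial.funext fun z => ?_
      rw [map_mul, map_zero, mul_eq_zero]
      by_cases hz : eval z (Y.det * ∏ j, T j) = 0
      · exact Or.inr hz
      left
      rw [map_mul, RingHom.map_det, map_prod, ← Ne, mul_ne_zero_iff, Finset.prod_ne_zero_iff] at hz
      let y : Matrix (Fin r) (Fin r) k := Matrix.of fun i j => z (Sum.inl (i, j))
      have hy : (eval z).mapMatrix Y = y := by ext i j; simp [Y, y]
      rw [hy] at hz
      have hu (j) : z (Sum.inr j) ≠ 0 := by simpa [T] using hz.2 j (Finset.mem_univ _)
      have hw : (Matrix.of fun i j => (y * v) i j * z (Sum.inr j)) ∈ matOrbit k v := by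
        refine ⟨Matrix.nonsingInvUnit y (isUnit_iff_ne_zero.2 hz.1),
          fun j => (Units.mk0 _ (hu j))⁻¹, ?_⟩
        ext i j
        simp only [inv_inv, Units.val_mk0, Matrix.of_apply]
        rfl
      have hz' : z = Sum.elim (fun ij : Fin r × Fin r => y ij.1 ij.2) (z ∘ Sum.inr) := by
        ext (_ | _) <;> rfl
      rw [← coe_aeval_eq_eval, RingHom.coe_coe, hz', aeval_genericOrbitPoint]
      simpa [coe_aeval_eq_eval] using hp _ hw
    exact (mul_eq_zero.1 hmul).resolve_right (mul_ne_zero (det_X_inl_ne_zero k _ _) hT)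
  · rintro hp _ ⟨g, t, rfl⟩
    have := aeval_genericOrbitPoint v g.1 (fun j => ((t j)⁻¹ : kˣ)) p
    rw [hp, map_zero] at this
    simpa [coe_aeval_eq_eval] using this.symm

/-- Polynomials vanishing on the orbit of `v` vanish on `y v diag(u)` over every `k`-algebra. -/
theorem aeval_eq_zero_of_mem_vanIdeal {k : Type*} [Field k] [Infinite k] {r n : ℕ}
    {v : Matrix (Fin r) (Fin n) k} {p : MvPolynomial (Fin r × Fin n) k}
    (hp : p ∈ vanIdeal k (matOrbit k v)) {R : Type*} [CommRing R] [Algebra k R]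
    (y : Matrix (Fin r) (Fin r) R) (u : Fin n → R) :
    aeval (fun ij => (y * v.map (algebraMap k R)) ij.1 ij.2 * u ij.2) p = 0 := by
  rw [← aeval_genericOrbitPoint, mem_vanIdeal_matOrbit_iff.1 hp, map_zero]

/-- The generic point of the orbit of `v`, over the function field of the group: it is
`y v diag(u)` with `y` and `u` invertible, and satisfies only the equations of the orbit. -/
theorem exists_generic_orbit_point.{uk} {k : Type uk} [Field k] [Infinite k] {r n : ℕ}
    (v : Matrix (Fin r) (Fin n) k) :
    ∃ (K : Type uk) (_ : Field K) (_ : Algebra k K) (y : Matrix (Fin r) (Fin r) K)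
      (u : Fin n → K), y.det ≠ 0 ∧ (∀ j, u j ≠ 0) ∧
      ∀ p : MvPolynomial (Fin r × Fin n) k,
        aeval (fun ij => (y * v.map (algebraMap k K)) ij.1 ij.2 * u ij.2) p = 0 →
        p ∈ vanIdeal k (matOrbit k v) := by
  let P := MvPolynomial ((Fin r × Fin r) ⊕ Fin n) k
  let K := FractionRing P
  have hinj : Function.Injective (algebraMap P K) := IsFractionRing.injective P K
  let Y : Matrix (Fin r) (Fin r) P := Matrix.of fun i j => X (Sum.inl (i, j))
  refine ⟨K, inferInstance, inferInstance, (algebraMap P K).mapMatrix Y,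
    fun j => algebraMap P K (X (Sum.inr j)), ?_, fun j => ?_, fun p hp => ?_⟩
  · rw [← RingHom.map_det]
    exact (map_ne_zero_iff _ hinj).2 (det_X_inl_ne_zero k _ _)
  · exact (map_ne_zero_iff _ hinj).2 (X_ne_zero _)
  · rw [mem_vanIdeal_matOrbit_iff]
    apply hinj
    have h := (aeval_genericOrbitPoint v ((algebraMap P K).mapMatrix Y)
      (fun j => algebraMap P K (X (Sum.inr j))) p).trans hp
    have hX : (Sum.elim (fun ij : Fin r × Fin r => (algebraMap P K).mapMatrix Y ij.1 ij.2)
        fun j : Fin n => algebraMap P K (X (Sum.inr j))) = algebraMap P K ∘ X := by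
      ext (_ | _) <;> rfl
    rwa [hX, aeval_algebraMap_apply, aeval_X_left_apply, ← map_zero (algebraMap P K)] at h

/-- If `v` has rank `r` and `w ∈ X_v` has rank `< r`, then `w = g·w'` for some full
rank `w' ∈ X_v` and some singular `g ∈ End(k^r)`. -/
theorem low_rank_points_from_projections
    {k : Type*} [Field k] [IsAlgClosed k] [CharZero k] {r n : ℕ}
    (v : Matrix (Fin r) (Fin n) k) (hv : v.rank = r)
    (w : Matrix (Fin r) (Fin n) k) (hw : w ∈ Xcl k v) (hwr : w.rank < r) :
    ∃ w' ∈ Xcl k v, w'.rank = r ∧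
      ∃ g : Matrix (Fin r) (Fin r) k, g.det = 0 ∧ w = g * w' := by
  obtain ⟨K, _, _, y, u, hy, hu, hgen⟩ := exists_generic_orbit_point v
  let U : Matrix (Fin r) (Fin n) K :=
    Matrix.of fun i j => (y * v.map (algebraMap k K)) i j * u j
  obtain ⟨B, hkB, hUB, hUw⟩ := exists_valuationSubring_specialization
    (fun ij : Fin r × Fin n => U ij.1 ij.2) (fun ij => w ij.1 ij.2) fun p hp => hw p (hgen p hp)
  have hUminor : ∃ c : Fin r → Fin n, (U.submatrix id c).det ≠ 0 := by
    obtain ⟨c, hc⟩ := exists_det_submatrix_ne_zero v hv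
    refine ⟨c, ?_⟩
    have hUc : U.submatrix id c =
        y * (v.submatrix id c).map (algebraMap k K) * Matrix.diagonal (u ∘ c) := by
      ext i j
      rw [Matrix.mul_diagonal]
      simp [U, Matrix.mul_apply]
    rw [hUc, Matrix.det_mul, Matrix.det_mul, Matrix.det_diagonal]
    refine mul_ne_zero (mul_ne_zero hy ?_) (Finset.prod_ne_zero_iff.2 fun j _ => hu _)
    rw [← RingHom.mapMatrix_apply, ← RingHom.map_det]
    simpa using hc
  obtain ⟨c, hc, hNB⟩ := B.exists_submatrix_inv_mul_mem U hUminor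
  have hcu : IsUnit (U.submatrix id c).det := isUnit_iff_ne_zero.2 hc
  let N : Matrix (Fin r) (Fin n) B := Matrix.of fun i j => ⟨_, hNB i j⟩
  let V : Matrix (Fin r) (Fin n) B := Matrix.of fun i j => ⟨U i j, hUB (i, j)⟩
  have hN : N.map B.subtype = (U.submatrix id c)⁻¹ * U := rfl
  have hV : V.map B.subtype = U := rfl
  have hinj : Function.Injective (B.subtype : B → K) := Subtype.val_injective
  have hVN : V = V.submatrix id c * N := by
    apply Matrix.map_injective hinj
    beta_reduce
    rw [Matrix.map_mul, ← Matrix.submatrix_map, hV, hN, Matrix.mul_nonsing_inv_cancel_left _ _ hcu]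
  have hN1 : N.submatrix id c = 1 := by
    apply Matrix.map_injective hinj
    beta_reduce
    rw [← Matrix.submatrix_map, hN, Matrix.submatrix_mul _ _ id id c Function.bijective_id,
      Matrix.submatrix_id_id, Matrix.nonsing_inv_mul _ hcu,
      Matrix.map_one _ (map_zero _) (map_one _)]
  let f : k →+* B := (algebraMap k K).codRestrict B.toSubring hkB
  have hNvan (p) (hp : p ∈ vanIdeal k (matOrbit k v)) :
      eval₂ f (fun ij => N ij.1 ij.2) p = 0 := by
    apply hinj
    rw [map_zero, ← aeval_eq_zero_of_mem_vanIdeal hp ((U.submatrix id c)⁻¹ * y) u]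
    rw [hom_eval₂, aeval_def]
    congr 1
    funext ij
    change ((U.submatrix id c)⁻¹ * U) ij.1 ij.2 = _
    simp only [U, Matrix.mul_assoc]
    rw [Matrix.mul_apply, Matrix.mul_apply, Finset.sum_mul]
    simp [mul_assoc]
  let ρ := IsLocalRing.residue B
  have hVw (i j) : ρ (V i j) = ρ (f (w i j)) := by
    rw [← sub_eq_zero, ← map_sub, IsLocalRing.residue_eq_zero_iff]
    exact ValuationSubring.coe_mem_nonunits_iff.1 (hUw (i, j))
  obtain ⟨x, hx⟩ := exists_eval_eq_zero_of_eval₂_eq_zero (ρ.comp f)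
    fun ij : Fin r × Fin n => ρ (N ij.1 ij.2)
  let w' : Matrix (Fin r) (Fin n) k := Matrix.of fun i j => x (i, j)
  have hw'1 : w'.submatrix id c = 1 := by
    ext i j
    have := hx (X (i, c j) - C ((1 : Matrix (Fin r) (Fin r) k) i j)) (by
      have h := congrFun (congrFun hN1 i) j
      rw [Matrix.submatrix_apply, id] at h
      rw [eval₂_sub, eval₂_X, eval₂_C, h]
      by_cases hij : i = j <;> simp [Matrix.one_apply, hij])
    simpa [sub_eq_zero, w'] using this
  have hww' : w = w.submatrix id c * w' := by
    ext i j
    have := hx (C (w i j) - ∑ a, C (w i (c a)) * X (a, j)) (by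
      have h := congrArg ρ (congrFun (congrFun hVN i) j)
      simp only [Matrix.mul_apply, map_sum, map_mul, Matrix.submatrix_apply, id, hVw] at h
      simp [eval₂_sub, eval₂_sum, h])
    simpa [sub_eq_zero, Matrix.mul_apply, w'] using this
  have hrank : w'.rank = r := by
    apply le_antisymm (by simpa using w'.rank_le_height)
    have := w'.rank_submatrix_le id c
    rwa [hw'1, Matrix.rank_one, Fintype.card_fin] at this
  refine ⟨w', fun p hp => hx p ?_, hrank, w.submatrix id c, ?_, hww'⟩
  · have := hom_eval₂ p f ρ fun ij : Fin r × Fin n => N ij.1 ij.2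
    rw [hNvan p hp, map_zero] at this
    exact this.symm
  · by_contra hdet
    have hle := w.rank_submatrix_le id c
    rw [Matrix.rank_of_isUnit _ ((Matrix.isUnit_iff_isUnit_det _).2 (isUnit_iff_ne_zero.2 hdet)),
      Fintype.card_fin] at hle
    omega
end
end

section
/- Let v, w ∈ k^{r×n}. Then w ∈ X_v if and only if the following holds: for every nonempty subset J ⊆ {1,…,n} and every matrix u ∈ k^{m×J} whose rows form a basis of the kernel ker(v_J) = {x ∈ k^J : ∑_{j∈J} x_j v_j = 0} (so m = |J| − rank(v_J)), the family of r×m matrices (w_j · (u_j)^T)_{j∈J} — where w_j is the j-th column of w, u_j ∈ k^m is the j-th column of u, and w_j · (u_j)^T is their outer product, representing the tensor w_j ⊗ u_j ∈ k^r ⊗ k^m — is linearly dependent over k. -/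
open MvPolynomial

noncomputable section

/-- Evaluating commutes with substituting univariate polynomials for the variables. -/
theorem eval_aeval_polynomial {k σ : Type*} [Field k] (q : σ → Polynomial k)
    (p : MvPolynomial σ k) (ε : k) :
    (aeval q p).eval ε = eval (fun i => (q i).eval ε) p := by
  rw [← Polynomial.coe_aeval_eq_eval, ← AlgHom.comp_apply, comp_aeval, ← coe_aeval_eq_eval]
  rfl

/-- A polynomial vanishing on the orbit of `v` vanishes at `A v diag(t)⁻¹` for every square
matrix `A`, invertible or not. -/
theorem eval_eq_zero_of_mem_vanIdeal {k : Type*} [Field k] [Infinite k] {r n : ℕ}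
    {v : Matrix (Fin r) (Fin n) k} {p : MvPolynomial (Fin r × Fin n) k}
    (hp : p ∈ vanIdeal k (matOrbit k v)) (A : Matrix (Fin r) (Fin r) k) (t : Fin n → kˣ) :
    eval (fun ij => (A * v) ij.1 ij.2 * ((t ij.2)⁻¹ : kˣ)) p = 0 := by
  let q : Fin r × Fin n → Polynomial k := fun ij =>
    (Polynomial.C ((A * v) ij.1 ij.2) + Polynomial.X * Polynomial.C (v ij.1 ij.2)) *
      Polynomial.C (((t ij.2)⁻¹ : kˣ) : k)
  have hq (ε : k) : (aeval q p).eval ε =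
      eval (fun ij => ((A + ε • (1 : Matrix (Fin r) (Fin r) k)) * v) ij.1 ij.2 *
        ((t ij.2)⁻¹ : kˣ)) p := by
    rw [eval_aeval_polynomial]
    congr 2
    funext ij
    simp [q, Matrix.add_mul, add_mul, mul_comm ε]
  have hprod : aeval q p * (-A).charpoly = 0 := by
    refine Polynomial.funext fun ε => ?_
    rw [Polynomial.eval_mul, hq, Matrix.eval_charpoly, Polynomial.eval_zero, mul_eq_zero,
      or_iff_not_imp_right]
    intro hdet
    have hunit : IsUnit (A + ε • 1 : Matrix (Fin r) (Fin r) k) := by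
      rw [Matrix.isUnit_iff_isUnit_det, isUnit_iff_ne_zero]
      rwa [sub_neg_eq_add, add_comm, Matrix.scalar_apply, ← Matrix.smul_one_eq_diagonal] at hdet
    obtain ⟨g, hg⟩ := hunit
    rw [← hg]
    exact hp (Matrix.of fun i j => (g.1 * v) i j * ((t j)⁻¹ : kˣ)) ⟨g, t, rfl⟩
  have hq0 := hq 0
  have h := (mul_eq_zero.mp hprod).resolve_right (Matrix.charpoly_monic (-A)).ne_zero
  rw [h, Polynomial.eval_zero, zero_smul, add_zero] at hq0
  exact hq0.symm

/-- A limit, as the parameter of a polynomial one-parameter family tends to `0`, of matrices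
`A v diag(t)⁻¹` lies in `X_v`. -/
theorem mem_Xcl_of_polynomial_family {k : Type*} [Field k] [Infinite k] {r n : ℕ}
    {v w : Matrix (Fin r) (Fin n) k} (G : Matrix (Fin r) (Fin r) (Polynomial k))
    (h : ∀ j, ∃ (c : kˣ) (e : ℕ) (q : Fin r → Polynomial k), ∀ i,
      (q i).eval 0 = c * w i j ∧
        ∑ l, G i l * Polynomial.C (v l j) = Polynomial.X ^ e * q i) :
    w ∈ Xcl k v := by
  choose c e q hq0 hq using h
  intro p hp
  let Q : Fin r × Fin n → Polynomial k := fun ij =>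
    q ij.2 ij.1 * Polynomial.C (((c ij.2)⁻¹ : kˣ) : k)
  have heval (ε : k) := eval_aeval_polynomial Q p ε
  have hprod : aeval Q p * Polynomial.X = 0 := by
    refine Polynomial.funext fun ε => ?_
    rw [Polynomial.eval_mul, Polynomial.eval_X, Polynomial.eval_zero, mul_eq_zero,
      or_iff_not_imp_right, heval]
    intro hε
    rw [← eval_eq_zero_of_mem_vanIdeal hp (G.map (Polynomial.eval ε))
      (fun j => Units.mk0 ε hε ^ e j * c j)]
    congr 2
    funext ij
    have := congrArg (Polynomial.eval ε) (hq ij.2 ij.1)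
    simp only [Polynomial.eval_finsetSum, Polynomial.eval_mul, Polynomial.eval_C,
      Polynomial.eval_pow, Polynomial.eval_X] at this
    simp only [Matrix.mul_apply, Matrix.map_apply, this]
    simp [Q]
    field_simp
  have h := (mul_eq_zero.mp hprod).resolve_right Polynomial.X_ne_zero
  have h0 := heval 0
  rw [h, Polynomial.eval_zero] at h0
  rw [h0]
  congr 2
  funext ij
  simp [Q, hq0, mul_comm]

/-- If on every nonempty set of columns some nonzero rescaling of `w` is the image of `v` under
a square matrix, then over every set of columns these matrices assemble to a polynomial
one-parameter family degenerating `v` to `w`. -/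
theorem exists_polynomial_family {k : Type*} [Field k] {r n : ℕ}
    {v w : Matrix (Fin r) (Fin n) k}
    (h : ∀ J : Finset (Fin n), J.Nonempty → ∃ (g : Matrix (Fin r) (Fin r) k) (t : Fin n → k),
      (∃ j ∈ J, t j ≠ 0) ∧ ∀ j ∈ J, ∀ i, (g * v) i j = t j * w i j)
    (J : Finset (Fin n)) :
    ∃ G : Matrix (Fin r) (Fin r) (Polynomial k),
      ∀ j ∈ J, ∃ (c : kˣ) (e : ℕ) (q : Fin r → Polynomial k), ∀ i,
        (q i).eval 0 = c * w i j ∧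
          ∑ l, G i l * Polynomial.C (v l j) = Polynomial.X ^ e * q i := by
  classical
  induction J using Finset.strongInduction with
  | H J ih =>
    rcases J.eq_empty_or_nonempty with rfl | hJ
    · exact ⟨0, by simp⟩
    obtain ⟨g, t, ⟨j₀, hj₀, ht₀⟩, hg⟩ := h J hJ
    obtain ⟨G, hG⟩ := ih (J.filter fun j => t j = 0)
      (Finset.filter_ssubset.mpr ⟨j₀, hj₀, ht₀⟩)
    have hsum (i : Fin r) (j : Fin n) :
        ∑ l, (g.map Polynomial.C + (Polynomial.X : Polynomial k) • G) i l * Polynomial.C (v l j) =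
          Polynomial.C ((g * v) i j) +
            Polynomial.X * ∑ l, G i l * Polynomial.C (v l j) := by
      simp [Matrix.mul_apply, add_mul, Finset.sum_add_distrib, Finset.mul_sum, mul_assoc]
    refine ⟨g.map Polynomial.C + (Polynomial.X : Polynomial k) • G, fun j hj => ?_⟩
    by_cases ht : t j = 0
    · obtain ⟨c, e, q, hq⟩ := hG j (Finset.mem_filter.mpr ⟨hj, ht⟩)
      refine ⟨c, e + 1, q, fun i => ⟨(hq i).1, ?_⟩⟩
      rw [hsum, hg j hj, ht, (hq i).2, pow_succ']
      simp [mul_assoc]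
    · refine ⟨Units.mk0 _ ht, 0, fun i => Polynomial.C ((g * v) i j) +
        Polynomial.X * ∑ l, G i l * Polynomial.C (v l j), fun i => ⟨?_, ?_⟩⟩
      · simp [hg j hj]
      · rw [hsum, pow_zero, one_mul]

/-- A linear relation among the tensors `w_j ⊗ u_j`, where the rows of `u` span the kernel of
`v`, comes from a square matrix sending each `v_j` to the corresponding multiple of `w_j`. -/
theorem exists_mul_eq_of_sum_tensor_eq_zero {k ι : Type*} [Field k] [Fintype ι] {r m : ℕ}
    {v w : Matrix (Fin r) ι k} {u : Matrix (Fin m) ι k}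
    (hu : Submodule.span k (Set.range u) = LinearMap.ker v.mulVecLin) {t : ι → k}
    (ht : ∀ i s, ∑ j, t j * (w i j * u s j) = 0) :
    ∃ g : Matrix (Fin r) (Fin r) k, ∀ i j, (g * v) i j = t j * w i j := by
  classical
  let φ : Fin r → Module.Dual k (ι → k) := fun i => dotProductBilin k k (fun j => t j * w i j)
  have hφ (i : Fin r) : φ i ∈ LinearMap.range v.mulVecLin.dualMap := by
    rw [LinearMap.range_dualMap_eq_dualAnnihilator_ker, ← hu, Submodule.mem_dualAnnihilator]
    intro x hx
    have hle : Submodule.span k (Set.range u) ≤ LinearMap.ker (φ i) := by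
      rw [Submodule.span_le]
      rintro _ ⟨s, rfl⟩
      simpa [φ, dotProduct, mul_assoc] using ht i s
    exact hle hx
  choose ψ hψ using hφ
  refine ⟨Matrix.of fun i l => ψ i (Pi.single l 1), fun i j => ?_⟩
  have h := LinearMap.congr_fun (hψ i) (Pi.single j 1)
  simp only [LinearMap.dualMap_apply, Matrix.mulVecLin_apply, Matrix.mulVec_single_one] at h
  rw [LinearMap.pi_apply_eq_sum_univ (ψ i)] at h
  simpa [φ, Matrix.mul_apply, mul_comm, Matrix.col, ← Pi.single_apply, Pi.single_comm] using h

/-- The tensors `w_j ⊗ u_j` are linearly dependent on the whole orbit closure `X_v` whenever the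
rows of `u` lie in the kernel of `v_J`. -/
theorem not_linearIndependent_tensor_of_mem_Xcl {k : Type*} [Field k] {r n m : ℕ}
    {v w : Matrix (Fin r) (Fin n) k} (hw : w ∈ Xcl k v) {J : Finset (Fin n)} (hJ : J.Nonempty)
    {u : Matrix (Fin m) J k} (hu : ∀ i s, ∑ j : J, v i j * u s j = 0) :
    ¬ LinearIndependent k
      (fun j : J => Matrix.of fun i (s : Fin m) => w i (j : Fin n) * u s j) := by
  classical
  intro hli
  obtain ⟨L, hL⟩ := LinearMap.exists_leftInverse_of_injective
    (Fintype.linearCombination k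
      (fun j : J => Matrix.of fun i (s : Fin m) => w i (j : Fin n) * u s j))
    (LinearMap.ker_eq_bot.mpr hli.fintypeLinearCombination_injective)
  let P : Matrix J J (MvPolynomial (Fin r × Fin n) k) := Matrix.of fun j j' =>
    ∑ i, ∑ s, X (i, (j : Fin n)) * C (u s j * L (Matrix.single i s 1) j')
  have hP (x : Matrix (Fin r) (Fin n) k) : eval (fun ij => x ij.1 ij.2) P.det =
      (Matrix.of fun j : J => L (Matrix.of fun i s => x i (j : Fin n) * u s j)).det := by
    rw [RingHom.map_det]
    congr 1
    ext j j'
    rw [Matrix.of_apply, Matrix.matrix_eq_sum_single (Matrix.of _)]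
    simp only [map_sum, Finset.sum_apply, RingHom.mapMatrix_apply, Matrix.map_apply, P,
      Matrix.of_apply, map_mul, eval_X, eval_C]
    refine Finset.sum_congr rfl fun i _ => Finset.sum_congr rfl fun s _ => ?_
    rw [← mul_one (x i j * u s j), ← smul_eq_mul (x i j * u s j), ← Matrix.smul_single, map_smul]
    simp [mul_assoc]
  have hmem : P.det ∈ vanIdeal k (matOrbit k v) := by
    rintro _ ⟨g, t, rfl⟩
    rw [hP]
    obtain ⟨j₀, hj₀⟩ := hJ
    refine Matrix.exists_vecMul_eq_zero_iff.mp ⟨fun j => t j, ?_, ?_⟩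
    · exact fun h => (t j₀).ne_zero (congrFun h ⟨j₀, hj₀⟩)
    · have hrel : ∑ j : J, (t j : k) • (Matrix.of fun i s =>
          (Matrix.of fun i j => (g.1 * v) i j * ((t j)⁻¹ : kˣ)) i (j : Fin n) * u s j) = 0 := by
        ext i s
        have (j : J) : (t j : k) * ((g.1 * v) i j * ((t j)⁻¹ : kˣ) * u s j) =
            ∑ l, g.1 i l * (v l j * u s j) := by
          simp only [← mul_assoc, ← Finset.sum_mul, ← Matrix.mul_apply]
          rw [mul_right_comm (t j : k), Units.mul_inv, one_mul]
        simp only [Matrix.sum_apply, Matrix.smul_apply, Matrix.of_apply, smul_eq_mul, this,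
          Matrix.zero_apply]
        rw [Finset.sum_comm]
        simp only [← Finset.mul_sum, hu, mul_zero, Finset.sum_const_zero]
      rw [Matrix.vecMul_eq_sum]
      have := congrArg L hrel
      simp only [map_sum, map_smul, map_zero] at this
      exact this
  have h0 := hw _ hmem
  rw [hP] at h0
  have hone : (Matrix.of fun j : J => L (Matrix.of fun i s => w i (j : Fin n) * u s j)) = 1 := by
    ext j j'
    have := LinearMap.congr_fun hL (Pi.single j 1)
    simp only [LinearMap.comp_apply, Fintype.linearCombination_apply_single, one_smul,
      LinearMap.id_apply] at this
    rw [Matrix.of_apply, this, Matrix.one_apply, Pi.single_apply]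
    simp [eq_comm]
  rw [hone, Matrix.det_one] at h0
  exact one_ne_zero h0

/-- `w ∈ X_v` iff for every nonempty `J ⊆ [n]` and every matrix `u` whose rows form a
basis of `ker(v_J)`, the family of outer products `(w_j ⊗ u_j)_{j ∈ J}` is linearly
dependent. -/
theorem mem_orbit_closure_iff_dependent_tensors
    {k : Type*} [Field k] [IsAlgClosed k] [CharZero k] {r n : ℕ}
    (v w : Matrix (Fin r) (Fin n) k) :
    w ∈ Xcl k v ↔
      ∀ J : Finset (Fin n), J.Nonempty →
        ∀ (m : ℕ) (u : Matrix (Fin m) J k),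
          LinearIndependent k (fun s : Fin m => u s) →
          Submodule.span k (Set.range u) =
            LinearMap.ker (Matrix.mulVecLin (Matrix.of fun i (j : J) => v i (j : Fin n))) →
          ¬ LinearIndependent k
              (fun j : J => Matrix.of fun i (s : Fin m) => w i (j : Fin n) * u s j) := by
  constructor
  · intro hw J hJ m u _ hu
    refine not_linearIndependent_tensor_of_mem_Xcl hw hJ fun i s => ?_
    have hs : u s ∈ LinearMap.ker
        (Matrix.mulVecLin (Matrix.of fun i (j : J) => v i (j : Fin n))) :=
      hu ▸ Submodule.subset_span ⟨s, rfl⟩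
    exact congrFun (LinearMap.mem_ker.mp hs) i
  · intro h
    have hcol : ∀ J : Finset (Fin n), J.Nonempty →
        ∃ (g : Matrix (Fin r) (Fin r) k) (t : Fin n → k),
          (∃ j ∈ J, t j ≠ 0) ∧ ∀ j ∈ J, ∀ i, (g * v) i j = t j * w i j := by
      classical
      intro J hJ
      let K := LinearMap.ker (Matrix.mulVecLin (Matrix.of fun i (j : J) => v i (j : Fin n)))
      let b := Module.finBasis k K
      let u : Matrix (Fin (Module.finrank k K)) J k := fun s => (b s : J → k)
      have hli : LinearIndependent k (fun s => u s) :=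
        b.linearIndependent.map' K.subtype K.ker_subtype
      have hspan : Submodule.span k (Set.range u) = K := by
        have : Set.range u = K.subtype '' Set.range b := by
          rw [← Set.range_comp]
          rfl
        rw [this, Submodule.span_image, b.span_eq, Submodule.map_subtype_top]
      obtain ⟨t, ht, j₀, hj₀⟩ := Fintype.not_linearIndependent_iff.mp (h J hJ _ u hli hspan)
      obtain ⟨g, hg⟩ := exists_mul_eq_of_sum_tensor_eq_zero
        (w := Matrix.of fun i (j : J) => w i (j : Fin n)) (t := t) hspan fun i s => by
          simpa [Matrix.sum_apply] using congrFun (congrFun ht i) s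
      refine ⟨g, fun j => if hj : j ∈ J then t ⟨j, hj⟩ else 0,
        ⟨j₀, j₀.2, by simpa using hj₀⟩, fun j hj i => ?_⟩
      simpa [hj, Matrix.mul_apply] using hg i ⟨j, hj⟩
    obtain ⟨G, hG⟩ := exists_polynomial_family hcol Finset.univ
    exact mem_Xcl_of_polynomial_family G fun j => hG j (Finset.mem_univ j)
end
end
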